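/- Let m ≥ 3 be odd and suppose the dihedral-type Artin group A(m), with Artin generators a and b, acts properly discontinuously by semi-simple isometries on a CAT(0) metric space X of covering dimension ≤ 2. Let Δ = (a,b)_m, z = Δ², and let j : [0,w] × ℝ → X (w > 0) be an isometric embedding with image B(a,b) = Min(a) ∩ Min(z) ∩ Min(b) whose lines j({s} × ℝ) are axes of z. Then (possibly after swapping the roles of the two boundary lines) the boundary line j({0} × ℝ) is invariant under the element ba and is an axis of ba, the boundary line j({w} × ℝ) is invariant under ab and is an axis of ab, the image a(j({0} × ℝ)) is an axis of ab contained in B(a,b), and the image b(j({w} × ℝ)) is an axis of ba contained in B(a,b). -/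

import Mathlib

/-! Common definitions: geodesic spaces, CAT(0) spaces, covering dimension,
translation length, semi-simple isometries, properly discontinuous actions,
ℝ-trees, axes, flat strips, and Artin group presentations. -/

/-- The alternating product `x y x y ⋯` of length `k`. -/
def altProd {G : Type*} [Monoid G] (x y : G) : ℕ → G
  | 0 => 1
  | Nat.succ k => x * altProd y x k

/-- `γ` is a geodesic from `x` to `y`, i.e. an isometric map of `[0, dist x y]`
into the space with endpoints `x` and `y`. -/
def IsGeodesic {X : Type*} [MetricSpace X] (x y : X) (γ : ℝ → X) : Prop :=
  γ 0 = x ∧ γ (dist x y) = y ∧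
    ∀ s ∈ Set.Icc (0:ℝ) (dist x y), ∀ t ∈ Set.Icc (0:ℝ) (dist x y),
      dist (γ s) (γ t) = |s - t|

/-- A metric space is geodesic if any two points are joined by a geodesic. -/
def IsGeodesicSpace (X : Type*) [MetricSpace X] : Prop :=
  ∀ x y : X, ∃ γ : ℝ → X, IsGeodesic x y γ

/-- The comparison point at arclength parameter `s` on the Euclidean segment from `x'`
to `y'`, where `d` is the length of the corresponding side of the original triangle. -/
noncomputable def cmpPoint (d : ℝ) (x' y' : EuclideanSpace ℝ (Fin 2)) (s : ℝ) :
    EuclideanSpace ℝ (Fin 2) :=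
  x' + (s / d) • (y' - x')

/-- A CAT(0) space: a geodesic metric space in which every geodesic triangle satisfies
the comparison inequality with respect to a comparison triangle in the Euclidean plane. -/
def IsCAT0 (X : Type*) [MetricSpace X] : Prop :=
  IsGeodesicSpace X ∧
  ∀ (x y z : X) (γ₁ γ₂ : ℝ → X), IsGeodesic x y γ₁ → IsGeodesic x z γ₂ →
    ∀ x' y' z' : EuclideanSpace ℝ (Fin 2),
      dist x' y' = dist x y → dist x' z' = dist x z → dist y' z' = dist y z →
      ∀ s ∈ Set.Icc (0:ℝ) (dist x y), ∀ t ∈ Set.Icc (0:ℝ) (dist x z),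
        dist (γ₁ s) (γ₂ t) ≤
          dist (cmpPoint (dist x y) x' y' s) (cmpPoint (dist x z) x' z' t)

/-- Covering dimension at most `n`: every open cover admits an open refinement in which
every point lies in at most `n + 1` members. -/
def CovDimLE (X : Type*) [TopologicalSpace X] (n : ℕ) : Prop :=
  ∀ U : Set (Set X), (∀ u ∈ U, IsOpen u) → ⋃₀ U = Set.univ →
    ∃ V : Set (Set X), (∀ v ∈ V, IsOpen v) ∧ ⋃₀ V = Set.univ ∧
      (∀ v ∈ V, ∃ u ∈ U, v ⊆ u) ∧
      ∀ x : X, ∃ F : Finset (Set X), F.card ≤ n + 1 ∧ {v | v ∈ V ∧ x ∈ v} ⊆ ↑F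

/-- The translation length of a self-map of a metric space. -/
noncomputable def transLen {X : Type*} [MetricSpace X] (f : X → X) : ℝ :=
  sInf (Set.range fun x => dist x (f x))

/-- A self-map is semi-simple if its translation length is attained. -/
def SemiSimple {X : Type*} [MetricSpace X] (f : X → X) : Prop :=
  ∃ x, dist x (f x) = transLen f

/-- The minset of a self-map of a metric space. -/
def MinSet {X : Type*} [MetricSpace X] (f : X → X) : Set X :=
  {x | dist x (f x) = transLen f}

/-- An action by isometries (given by a homomorphism to the isometry group) is properly
discontinuous if each compact set meets only finitely many of its translates. -/
def ProperlyDisc {G X : Type*} [Group G] [MetricSpace X] (φ : G →* (X ≃ᵢ X)) : Prop :=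
  ∀ K : Set X, IsCompact K → Set.Finite {g : G | ((φ g) '' K ∩ K).Nonempty}

/-- An ℝ-tree: a geodesic metric space satisfying the four-point condition. -/
def IsRTree (T : Type*) [MetricSpace T] : Prop :=
  IsGeodesicSpace T ∧
  ∀ x y z w : T,
    dist x y + dist z w ≤ max (dist x z + dist y w) (dist x w + dist y z)

/-- `L` is an axis of `f`: an `f`-invariant geodesic line along which `f` translates
by its translation length. -/
def IsAxisOf {X : Type*} [MetricSpace X] (f : X → X) (L : Set X) : Prop :=
  ∃ c : ℝ → X, (∀ s t : ℝ, dist (c s) (c t) = |s - t|) ∧ Set.range c = L ∧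
    ∀ t : ℝ, f (c t) = c (t + transLen f)

/-- `j` is an isometric embedding of the Euclidean strip `[0,w] × ℝ` into `X`. -/
def FlatStrip {X : Type*} [MetricSpace X] (w : ℝ) (j : Set.Icc (0:ℝ) w × ℝ → X) : Prop :=
  ∀ p q : Set.Icc (0:ℝ) w × ℝ,
    dist (j p) (j q) = Real.sqrt (((p.1 : ℝ) - (q.1 : ℝ))^2 + (p.2 - q.2)^2)

/-- The set `S` is a flat strip of some positive width `w`, each of whose vertical lines
is an axis of `f`. -/
def StripWithAxes {X : Type*} [MetricSpace X] (f : X → X) (S : Set X) : Prop :=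
  ∃ w : ℝ, 0 < w ∧ ∃ j : Set.Icc (0:ℝ) w × ℝ → X,
    FlatStrip w j ∧ Set.range j = S ∧
    ∀ s : Set.Icc (0:ℝ) w, IsAxisOf f (Set.range fun t : ℝ => j (s, t))

/-- The relations of the Artin group `A(m,n,2)` on generators `a = 0`, `b = 1`, `c = 2`:
`(a,b)_m = (b,a)_m`, `(b,c)_n = (c,b)_n` and `ac = ca`. -/
def artinRel3 (m n : ℕ) : Set (FreeGroup (Fin 3)) :=
  { altProd (FreeGroup.of 0) (FreeGroup.of 1) m *
      (altProd (FreeGroup.of 1) (FreeGroup.of 0) m)⁻¹,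
    altProd (FreeGroup.of 1) (FreeGroup.of 2) n *
      (altProd (FreeGroup.of 2) (FreeGroup.of 1) n)⁻¹,
    FreeGroup.of 0 * FreeGroup.of 2 * (FreeGroup.of 0)⁻¹ * (FreeGroup.of 2)⁻¹ }

/-- The relation of the dihedral-type Artin group `A(m)` on generators `a = 0`, `b = 1`:
`(a,b)_m = (b,a)_m`. -/
def dihedralRel (m : ℕ) : Set (FreeGroup (Fin 2)) :=
  { altProd (FreeGroup.of 0) (FreeGroup.of 1) m *
      (altProd (FreeGroup.of 1) (FreeGroup.of 0) m)⁻¹ }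

/-- The conditions on the two boundary lines `ℓ` and `ℓ'` of the band `B(a,b)`:
`ℓ` is `ba`-invariant and a `ba`-axis, `ℓ'` is `ab`-invariant and an `ab`-axis,
`a(ℓ)` is an `ab`-axis contained in `B`, and `b(ℓ')` is a `ba`-axis contained in `B`. -/
def BoundaryConds {X : Type*} [MetricSpace X] (fa fb fab fba : X → X)
    (B L L' : Set X) : Prop :=
  fba '' L = L ∧ IsAxisOf fba L ∧
  fab '' L' = L' ∧ IsAxisOf fab L' ∧
  IsAxisOf fab (fa '' L) ∧ fa '' L ⊆ B ∧
  IsAxisOf fba (fb '' L') ∧ fb '' L' ⊆ B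


section Sperner

/-- Indicator, modulo two, that the two labels are `0` and `1`. -/
def edgeInd (p q : Fin 4) : ZMod 2 := if (p = 0 ∧ q = 1) ∨ (p = 1 ∧ q = 0) then 1 else 0

/-- Indicator, modulo two, that the three labels are `0`, `1` and `2`. -/
def triInd (p q r : Fin 4) : ZMod 2 :=
  if (∃ i ∈ [p, q, r], i = 0) ∧ (∃ i ∈ [p, q, r], i = 1) ∧ (∃ i ∈ [p, q, r], i = 2) then 1 else 0

lemma triInd_eq_edgeInd : ∀ p q r : Fin 4, p ≠ 3 → q ≠ 3 → r ≠ 3 →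
    triInd p q r = edgeInd p q + edgeInd q r + edgeInd p r := by
  decide

lemma triInd_eq_zero : ∀ c : Fin 4, c ≠ 3 → ∀ p q r : Fin 4, p ≠ c → q ≠ c → r ≠ c →
    triInd p q r = 0 := by
  decide

lemma exists_label_of_triInd : ∀ p q r s : Fin 4,
    triInd q r s + triInd p r s + triInd p q s + triInd p q r ≠ 0 →
    ∀ c : Fin 4, p = c ∨ q = c ∨ r = c ∨ s = c := by
  decide

lemma sum_range_add_succ_zmod_two (f : ℕ → ZMod 2) (n : ℕ) :
    ∑ i ∈ Finset.range n, (f i + f (i + 1)) = f 0 + f n := by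
  induction n with
  | zero => simp [CharTwo.add_self_eq_zero]
  | succ n ih =>
    rw [Finset.sum_range_succ, ih]
    linear_combination CharTwo.add_self_eq_zero (f n)

/-- Sperner's lemma on an edge. -/
lemma sum_edgeInd (n : ℕ) (l : ℕ → Fin 4) (h0 : l 0 = 0) (hn : l n = 1)
    (h : ∀ i ≤ n, l i = 0 ∨ l i = 1) :
    ∑ i ∈ Finset.range n, edgeInd (l i) (l (i + 1)) = 1 := by
  have key : ∀ p q : Fin 4, (p = 0 ∨ p = 1) → (q = 0 ∨ q = 1) →
      edgeInd p q = (if p = 1 then 1 else 0) + (if q = 1 then 1 else 0) := by decide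
  rw [Finset.sum_congr rfl fun i hi => key _ _
    (h i (Finset.mem_range.1 hi).le) (h (i + 1) (Finset.mem_range.1 hi))]
  rw [sum_range_add_succ_zmod_two (fun i => if l i = 1 then 1 else 0)]
  simp [h0, hn]

/-- Sperner's lemma on a triangulated square. -/
lemma sum_triInd (n : ℕ) (l : ℕ → ℕ → Fin 4)
    (h1 : ∀ j, l 0 j ≠ 1) (h2 : ∀ i, l i 0 ≠ 2) (h3 : ∀ i j, l i j ≠ 3)
    (h0 : ∀ j, l n j ≠ 0) (h0' : ∀ i, l i n ≠ 0) :
    ∑ i ∈ Finset.range n, ∑ j ∈ Finset.range n,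
      (triInd (l i j) (l (i + 1) j) (l (i + 1) (j + 1)) +
        triInd (l i j) (l i (j + 1)) (l (i + 1) (j + 1))) = 1 := by
  have e : ∀ i j, triInd (l i j) (l (i + 1) j) (l (i + 1) (j + 1)) +
        triInd (l i j) (l i (j + 1)) (l (i + 1) (j + 1)) =
      (edgeInd (l i j) (l i (j + 1)) + edgeInd (l (i + 1) j) (l (i + 1) (j + 1))) +
      (edgeInd (l i j) (l (i + 1) j) + edgeInd (l i (j + 1)) (l (i + 1) (j + 1))) := by
    intro i j
    rw [triInd_eq_edgeInd _ _ _ (h3 _ _) (h3 _ _) (h3 _ _),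
      triInd_eq_edgeInd _ _ _ (h3 _ _) (h3 _ _) (h3 _ _)]
    linear_combination CharTwo.add_self_eq_zero (edgeInd (l i j) (l (i + 1) (j + 1)))
  have k1 : ∀ p q : Fin 4, p ≠ 1 → q ≠ 1 → edgeInd p q = 0 := by decide
  have k0 : ∀ p q : Fin 4, p ≠ 0 → q ≠ 0 → edgeInd p q = 0 := by decide
  have k2 : ∀ p : Fin 4, p ≠ 2 → p ≠ 3 → p = 0 ∨ p = 1 := by decide
  simp_rw [e, Finset.sum_add_distrib (f := fun j => edgeInd _ (l _ (j + 1)) + _)]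
  rw [Finset.sum_add_distrib, Finset.sum_comm]
  have a1 : ∀ j, ∑ i ∈ Finset.range n,
      (edgeInd (l i j) (l i (j + 1)) + edgeInd (l (i + 1) j) (l (i + 1) (j + 1))) = 0 := by
    intro j
    rw [sum_range_add_succ_zmod_two (fun i => edgeInd (l i j) (l i (j + 1))),
      k1 _ _ (h1 _) (h1 _), k0 _ _ (h0 _) (h0 _), add_zero]
  have a2 : ∀ i, ∑ j ∈ Finset.range n,
      (edgeInd (l i j) (l (i + 1) j) + edgeInd (l i (j + 1)) (l (i + 1) (j + 1))) =
        edgeInd (l i 0) (l (i + 1) 0) := by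
    intro i
    rw [sum_range_add_succ_zmod_two (fun j => edgeInd (l i j) (l (i + 1) j)),
      k0 _ _ (h0' _) (h0' _), add_zero]
  simp_rw [a1, a2]
  rw [Finset.sum_const_zero, zero_add]
  refine sum_edgeInd n (fun i => l i 0) ?_ ?_ fun i _ => k2 _ (h2 _) (h3 _ _)
  · exact (k2 _ (h2 0) (h3 _ _)).resolve_right (h1 0)
  · exact (k2 _ (h2 n) (h3 _ _)).resolve_left (h0 0)

/-- Sperner's lemma on a triangulated cube: some small cube carries all four labels. -/
lemma exists_cube_all_labels (n : ℕ) (l : ℕ → ℕ → ℕ → Fin 4)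
    (h1 : ∀ j k, l 0 j k ≠ 1) (h2 : ∀ i k, l i 0 k ≠ 2) (h3 : ∀ i j, l i j 0 ≠ 3)
    (hx : ∀ j k, l n j k ≠ 0) (hy : ∀ i k, l i n k ≠ 0) (hz : ∀ i j, l i j n ≠ 0) :
    ∃ i < n, ∃ j < n, ∃ k < n, ∀ c : Fin 4, ∃ i' j' k', (i ≤ i' ∧ i' ≤ i + 1) ∧
      (j ≤ j' ∧ j' ≤ j + 1) ∧ (k ≤ k' ∧ k' ≤ k + 1) ∧ l i' j' k' = c := by
  by_contra hcon
  set T : Fin 4 → Fin 4 → Fin 4 → Fin 4 → ZMod 2 := fun p q r s =>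
    triInd q r s + triInd p r s + triInd p q s + triInd p q r with hT
  set Sx : ℕ → ℕ → ℕ → ZMod 2 := fun i j k =>
    triInd (l i j k) (l i (j + 1) k) (l i (j + 1) (k + 1)) +
      triInd (l i j k) (l i j (k + 1)) (l i (j + 1) (k + 1)) with hSx
  set Sy : ℕ → ℕ → ℕ → ZMod 2 := fun i j k =>
    triInd (l i j k) (l (i + 1) j k) (l (i + 1) j (k + 1)) +
      triInd (l i j k) (l i j (k + 1)) (l (i + 1) j (k + 1)) with hSy
  set Sz : ℕ → ℕ → ℕ → ZMod 2 := fun i j k =>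
    triInd (l i j k) (l (i + 1) j k) (l (i + 1) (j + 1) k) +
      triInd (l i j k) (l i (j + 1) k) (l (i + 1) (j + 1) k) with hSz
  have hcell : ∀ i ∈ Finset.range n, ∀ j ∈ Finset.range n, ∀ k ∈ Finset.range n,
      ((Sx i j k + Sx (i + 1) j k) + (Sy i j k + Sy i (j + 1) k)) +
        (Sz i j k + Sz i j (k + 1)) = 0 := by
    intro i hi j hj k hk
    have hz : ∀ i1 j1 k1 i2 j2 k2, (i ≤ i1 ∧ i1 ≤ i + 1) → (j ≤ j1 ∧ j1 ≤ j + 1) →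
        (k ≤ k1 ∧ k1 ≤ k + 1) → (i ≤ i2 ∧ i2 ≤ i + 1) → (j ≤ j2 ∧ j2 ≤ j + 1) →
        (k ≤ k2 ∧ k2 ≤ k + 1) →
        T (l i j k) (l i1 j1 k1) (l i2 j2 k2) (l (i + 1) (j + 1) (k + 1)) = 0 := by
      intro i1 j1 k1 i2 j2 k2 a1 a2 a3 b1 b2 b3
      by_contra hne
      refine hcon ⟨i, Finset.mem_range.1 hi, j, Finset.mem_range.1 hj, k,
        Finset.mem_range.1 hk, fun c => ?_⟩
      rcases exists_label_of_triInd _ _ _ _ hne c with h | h | h | h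
      · exact ⟨i, j, k, by omega, by omega, by omega, h⟩
      · exact ⟨i1, j1, k1, a1, a2, a3, h⟩
      · exact ⟨i2, j2, k2, b1, b2, b3, h⟩
      · exact ⟨i + 1, j + 1, k + 1, by omega, by omega, by omega, h⟩
    have t1 := hz (i + 1) j k (i + 1) (j + 1) k (by omega) (by omega) (by omega) (by omega)
      (by omega) (by omega)
    have t2 := hz (i + 1) j k (i + 1) j (k + 1) (by omega) (by omega) (by omega) (by omega)
      (by omega) (by omega)
    have t3 := hz i (j + 1) k (i + 1) (j + 1) k (by omega) (by omega) (by omega) (by omega)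
      (by omega) (by omega)
    have t4 := hz i (j + 1) k i (j + 1) (k + 1) (by omega) (by omega) (by omega) (by omega)
      (by omega) (by omega)
    have t5 := hz i j (k + 1) (i + 1) j (k + 1) (by omega) (by omega) (by omega) (by omega)
      (by omega) (by omega)
    have t6 := hz i j (k + 1) i (j + 1) (k + 1) (by omega) (by omega) (by omega) (by omega)
      (by omega) (by omega)
    simp only [hT] at t1 t2 t3 t4 t5 t6
    simp only [hSx, hSy, hSz]
    have two : (2 : ZMod 2) = 0 := rfl
    set P := l i j k
    set Q := l (i + 1) (j + 1) (k + 1)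
    linear_combination t1 + t2 + t3 + t4 + t5 + t6 - two *
      (triInd P (l (i + 1) (j + 1) k) Q + triInd P (l (i + 1) j (k + 1)) Q +
        triInd P (l i (j + 1) (k + 1)) Q + triInd P (l (i + 1) j k) Q +
        triInd P (l i (j + 1) k) Q + triInd P (l i j (k + 1)) Q)
  have hsum := Finset.sum_eq_zero fun i hi => Finset.sum_eq_zero fun j hj =>
    Finset.sum_eq_zero fun k hk => hcell i hi j hj k hk
  simp_rw [Finset.sum_add_distrib (g := fun k => Sz _ _ k + _),
    Finset.sum_add_distrib (f := fun k => Sx _ _ k + _)] at hsum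
  have ez : ∀ i j, ∑ k ∈ Finset.range n, (Sz i j k + Sz i j (k + 1)) = Sz i j 0 := by
    intro i j
    rw [sum_range_add_succ_zmod_two (fun k => Sz i j k)]
    simp only [hSz]
    rw [triInd_eq_zero 0 (by decide) _ _ _ (hz _ _) (hz _ _) (hz _ _),
      triInd_eq_zero 0 (by decide) _ _ _ (hz _ _) (hz _ _) (hz _ _)]
    simp
  have ey : ∀ i k, ∑ j ∈ Finset.range n, (Sy i j k + Sy i (j + 1) k) = 0 := by
    intro i k
    rw [sum_range_add_succ_zmod_two (fun j => Sy i j k)]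
    simp only [hSy]
    rw [triInd_eq_zero 0 (by decide) _ _ _ (hy _ _) (hy _ _) (hy _ _),
      triInd_eq_zero 0 (by decide) _ _ _ (hy _ _) (hy _ _) (hy _ _),
      triInd_eq_zero 2 (by decide) _ _ _ (h2 _ _) (h2 _ _) (h2 _ _),
      triInd_eq_zero 2 (by decide) _ _ _ (h2 _ _) (h2 _ _) (h2 _ _)]
    simp
  have ex : ∀ j k, ∑ i ∈ Finset.range n, (Sx i j k + Sx (i + 1) j k) = 0 := by
    intro j k
    rw [sum_range_add_succ_zmod_two (fun i => Sx i j k)]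
    simp only [hSx]
    rw [triInd_eq_zero 0 (by decide) _ _ _ (hx _ _) (hx _ _) (hx _ _),
      triInd_eq_zero 0 (by decide) _ _ _ (hx _ _) (hx _ _) (hx _ _),
      triInd_eq_zero 1 (by decide) _ _ _ (h1 _ _) (h1 _ _) (h1 _ _),
      triInd_eq_zero 1 (by decide) _ _ _ (h1 _ _) (h1 _ _) (h1 _ _)]
    simp
  have sx : ∑ i ∈ Finset.range n, ∑ j ∈ Finset.range n, ∑ k ∈ Finset.range n,
      (Sx i j k + Sx (i + 1) j k) = 0 := by
    rw [Finset.sum_comm]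
    refine Finset.sum_eq_zero fun j _ => ?_
    rw [Finset.sum_comm]
    exact Finset.sum_eq_zero fun k _ => ex j k
  have sy : ∑ i ∈ Finset.range n, ∑ j ∈ Finset.range n, ∑ k ∈ Finset.range n,
      (Sy i j k + Sy i (j + 1) k) = 0 := by
    refine Finset.sum_eq_zero fun i _ => ?_
    rw [Finset.sum_comm]
    exact Finset.sum_eq_zero fun k _ => ey i k
  have sz : ∑ i ∈ Finset.range n, ∑ j ∈ Finset.range n, ∑ k ∈ Finset.range n,
      (Sz i j k + Sz i j (k + 1)) = 1 := by
    simp_rw [ez]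
    exact sum_triInd n (fun i j => l i j 0) (fun j => h1 j 0) (fun i => h2 i 0) h3
      (fun j => hx j 0) (fun i => hy i 0)
  simp only [Finset.sum_add_distrib] at hsum sx sy sz
  rw [sx, sy, sz] at hsum
  simp at hsum

end Sperner

section Dimension

open unitInterval

/-- The four closed subsets of the boundary of the cube which play the roles of the four
facets of a tetrahedron: three faces at the origin, and the union of the opposite ones. -/
def cubeFacet (c : Fin 4) : Set (I × I × I) :=
  {p | (c = 0 ∧ (p.1 = 1 ∨ p.2.1 = 1 ∨ p.2.2 = 1)) ∨ (c = 1 ∧ p.1 = 0) ∨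
    (c = 2 ∧ p.2.1 = 0) ∨ (c = 3 ∧ p.2.2 = 0)}

lemma isClosed_cubeFacet (c : Fin 4) : IsClosed (cubeFacet c) := by
  have e1 : IsClosed {p : I × I × I | p.1 = 1 ∨ p.2.1 = 1 ∨ p.2.2 = 1} :=
    (isClosed_eq (by fun_prop) (by fun_prop)).union
      ((isClosed_eq (by fun_prop) (by fun_prop)).union
        (isClosed_eq (by fun_prop) (by fun_prop)))
  have e2 : IsClosed {p : I × I × I | p.1 = 0} := isClosed_eq (by fun_prop) (by fun_prop)
  have e3 : IsClosed {p : I × I × I | p.2.1 = 0} := isClosed_eq (by fun_prop) (by fun_prop)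
  have e4 : IsClosed {p : I × I × I | p.2.2 = 0} := isClosed_eq (by fun_prop) (by fun_prop)
  fin_cases c <;> simpa [cubeFacet]

/-- The Knaster–Kuratowski–Mazurkiewicz lemma on the cube, for open covers. -/
lemma exists_mem_of_cover_cube (O : Fin 4 → Set (I × I × I)) (hO : ∀ c, IsOpen (O c))
    (hcov : ∀ p, ∃ c, p ∈ O c) (hF : ∀ c, ∀ p ∈ O c, p ∉ cubeFacet c) :
    ∃ p, ∀ c, p ∈ O c := by
  obtain ⟨δ, hδ, hball⟩ := lebesgue_number_lemma_of_metric isCompact_univ hO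
    (fun p _ => Set.mem_iUnion.2 (hcov p))
  choose! lab hlab using hball
  obtain ⟨n, hn⟩ := exists_nat_one_div_lt hδ
  set N : ℝ := (n : ℝ) + 1 with hN
  have hNpos : 0 < N := by positivity
  let u : ℕ → I := fun i => Set.projIcc 0 1 zero_le_one ((i : ℝ) / N)
  have hu0 : u 0 = 0 := by
    simp only [u, Nat.cast_zero, zero_div]
    exact Set.projIcc_left (zero_le_one (α := ℝ))
  have hu1 : u (n + 1) = 1 := by
    simp only [u]
    push_cast
    rw [div_self hNpos.ne']
    exact Set.projIcc_right (zero_le_one (α := ℝ))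
  have hud : ∀ i i' j' : ℕ, (i ≤ i' ∧ i' ≤ i + 1) → (i ≤ j' ∧ j' ≤ i + 1) →
      dist (u i') (u j') < δ := by
    intro i i' j' h1 h2
    have hl : dist (u i') (u j') ≤ dist ((i' : ℝ) / N) ((j' : ℝ) / N) := by
      simpa using (LipschitzWith.projIcc (a := (0 : ℝ)) (b := 1) zero_le_one).dist_le_mul
        ((i' : ℝ) / N) ((j' : ℝ) / N)
    refine hl.trans_lt (lt_of_le_of_lt ?_ hn)
    rw [Real.dist_eq, ← sub_div, abs_div, abs_of_pos hNpos]
    gcongr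
    rw [abs_le]
    have a1 : (i' : ℝ) ≤ (j' : ℝ) + 1 := by exact_mod_cast (by omega : i' ≤ j' + 1)
    have a2 : (j' : ℝ) ≤ (i' : ℝ) + 1 := by exact_mod_cast (by omega : j' ≤ i' + 1)
    constructor <;> linarith
  have hne : ∀ p c, p ∈ cubeFacet c → lab p ≠ c := by
    intro p c hp h
    exact hF (lab p) p (hlab p trivial (Metric.mem_ball_self hδ)) (h ▸ hp)
  obtain ⟨i, -, j, -, k, -, h⟩ := exists_cube_all_labels (n + 1)
    (fun i j k => lab (u i, u j, u k))
    (fun j k => hne _ _ (by simp [cubeFacet, hu0]))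
    (fun j k => hne _ _ (by simp [cubeFacet, hu0]))
    (fun j k => hne _ _ (by simp [cubeFacet, hu0]))
    (fun j k => hne _ _ (by simp [cubeFacet, hu1]))
    (fun j k => hne _ _ (by simp [cubeFacet, hu1]))
    (fun j k => hne _ _ (by simp [cubeFacet, hu1]))
  refine ⟨(u i, u j, u k), fun c => ?_⟩
  obtain ⟨i', j', k', hi, hj, hk, rfl⟩ := h c
  refine hlab (u i', u j', u k') trivial ?_
  rw [Metric.mem_ball, Prod.dist_eq, Prod.dist_eq]
  exact max_lt (hud i _ _ (by omega) hi)
    (max_lt (hud j _ _ (by omega) hj) (hud k _ _ (by omega) hk))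

/-- In a space of covering dimension at most two, the images of the four facets of a
continuous singular cube have a common point. -/
lemma CovDimLE.exists_mem_image_cubeFacet {X : Type*} [MetricSpace X] (hX : CovDimLE X 2)
    (f : I × I × I → X) (hf : Continuous f) : ∃ x, ∀ c, x ∈ f '' cubeFacet c := by
  classical
  by_contra! hcon
  have hcl : ∀ c, IsClosed (f '' cubeFacet c) := fun c =>
    ((isClosed_cubeFacet c).isCompact.image hf).isClosed
  obtain ⟨V, hVo, hVc, hVr, hVm⟩ := hX (Set.range fun c => (f '' cubeFacet c)ᶜ)
    (by rintro _ ⟨c, rfl⟩; exact (hcl c).isOpen_compl)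
    (by
      refine Set.eq_univ_of_forall fun x => ?_
      obtain ⟨c, hc⟩ := hcon x
      exact ⟨_, ⟨c, rfl⟩, hc⟩)
  have hVr' : ∀ v ∈ V, ∃ c : Fin 4, v ⊆ (f '' cubeFacet c)ᶜ := by
    intro v hv
    obtain ⟨_, ⟨c, rfl⟩, h⟩ := hVr v hv
    exact ⟨c, h⟩
  choose! idx hidx using hVr'
  obtain ⟨p, hp⟩ := exists_mem_of_cover_cube
    (fun c => f ⁻¹' ⋃₀ {v | v ∈ V ∧ idx v = c})
    (fun c => (isOpen_sUnion fun v hv => hVo v hv.1).preimage hf)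
    (fun p => by
      obtain ⟨v, hv, hpv⟩ : f p ∈ ⋃₀ V := hVc ▸ Set.mem_univ _
      exact ⟨idx v, v, ⟨hv, rfl⟩, hpv⟩)
    (by
      rintro c p ⟨v, ⟨hv, rfl⟩, hpv⟩ hpc
      exact hidx v hv hpv ⟨p, hpc, rfl⟩)
  choose v hv hpv using hp
  obtain ⟨F, hF, hVF⟩ := hVm (f p)
  have hinj : Function.Injective v := fun c c' h => by
    rw [← (hv c).2, ← (hv c').2, h]
  have hsub : Finset.univ.image v ⊆ F := by
    intro s hs
    obtain ⟨c, -, rfl⟩ := Finset.mem_image.1 hs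
    exact hVF ⟨(hv c).1, hpv c⟩
  have := Finset.card_le_card hsub
  rw [Finset.card_image_of_injective _ hinj, Finset.card_univ, Fintype.card_fin] at this
  omega

end Dimension

section CAT0

/-- Comparison triangles exist. -/
lemma exists_comparison_triangle (a b c : ℝ) (ha : 0 ≤ a) (hb : 0 ≤ b) (hc : 0 ≤ c)
    (h1 : a ≤ b + c) (h2 : b ≤ a + c) (h3 : c ≤ a + b) :
    ∃ x y z : EuclideanSpace ℝ (Fin 2), dist x y = c ∧ dist x z = b ∧ dist y z = a := by
  rcases hc.eq_or_lt with rfl | hc'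
  · have hab : a = b := by linarith
    subst hab
    refine ⟨!₂[0, 0], !₂[0, 0], !₂[a, 0], ?_, ?_, ?_⟩ <;>
      simp [EuclideanSpace.dist_eq, ha]
  · set u := (b ^ 2 + c ^ 2 - a ^ 2) / (2 * c) with hu
    have huc : 2 * c * u = b ^ 2 + c ^ 2 - a ^ 2 := by rw [hu]; field_simp
    have hub : u ^ 2 ≤ b ^ 2 := by
      have : (2 * c * u) ^ 2 ≤ (2 * c * b) ^ 2 := by
        rw [huc]
        refine sq_le_sq' ?_ ?_
        · nlinarith
        · nlinarith
      have hc2 : 0 < (2 * c) ^ 2 := by positivity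
      rw [mul_pow, mul_pow (2 * c)] at this
      exact le_of_mul_le_mul_left this hc2
    have hv : Real.sqrt (b ^ 2 - u ^ 2) ^ 2 = b ^ 2 - u ^ 2 := Real.sq_sqrt (by linarith)
    refine ⟨!₂[0, 0], !₂[c, 0], !₂[u, Real.sqrt (b ^ 2 - u ^ 2)], ?_, ?_, ?_⟩
    · simp [EuclideanSpace.dist_eq, hc]
    · simp only [EuclideanSpace.dist_eq, Fin.sum_univ_two, Real.dist_eq, sq_abs]
      rw [Real.sqrt_eq_iff_mul_self_eq (by positivity) hb]
      simp
      linarith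
    · simp only [EuclideanSpace.dist_eq, Fin.sum_univ_two, Real.dist_eq, sq_abs]
      rw [Real.sqrt_eq_iff_mul_self_eq (by positivity) ha]
      simp
      linarith

variable {X : Type*} [MetricSpace X]

/-- The point of the (chosen) geodesic from `x` to `y` at the proportion `s`. -/
noncomputable def geod (hX : IsCAT0 X) (x y : X) (s : ℝ) : X :=
  Classical.choose (hX.1 x y) (s * dist x y)

lemma mul_dist_mem_Icc {x y : X} {s : ℝ} (h : s ∈ Set.Icc (0 : ℝ) 1) :
    s * dist x y ∈ Set.Icc (0 : ℝ) (dist x y) :=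
  ⟨mul_nonneg h.1 dist_nonneg, mul_le_of_le_one_left dist_nonneg h.2⟩

lemma geod_zero (hX : IsCAT0 X) (x y : X) : geod hX x y 0 = x := by
  rw [geod, zero_mul]
  exact (Classical.choose_spec (hX.1 x y)).1

lemma geod_one (hX : IsCAT0 X) (x y : X) : geod hX x y 1 = y := by
  rw [geod, one_mul]
  exact (Classical.choose_spec (hX.1 x y)).2.1

lemma dist_geod_geod (hX : IsCAT0 X) (x y : X) {s t : ℝ} (hs : s ∈ Set.Icc (0 : ℝ) 1)
    (ht : t ∈ Set.Icc (0 : ℝ) 1) :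
    dist (geod hX x y s) (geod hX x y t) = |s - t| * dist x y := by
  rw [geod, geod, (Classical.choose_spec (hX.1 x y)).2.2 _ (mul_dist_mem_Icc hs) _
    (mul_dist_mem_Icc ht), ← sub_mul, abs_mul, abs_of_nonneg (dist_nonneg (x := x))]

lemma dist_left_geod (hX : IsCAT0 X) (x y : X) {s : ℝ} (hs : s ∈ Set.Icc (0 : ℝ) 1) :
    dist x (geod hX x y s) = s * dist x y := by
  have := dist_geod_geod hX x y (s := 0) (t := s) ⟨le_rfl, zero_le_one⟩ hs
  rwa [geod_zero, zero_sub, abs_neg, abs_of_nonneg hs.1] at this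

lemma dist_geod_right (hX : IsCAT0 X) (x y : X) {s : ℝ} (hs : s ∈ Set.Icc (0 : ℝ) 1) :
    dist (geod hX x y s) y = (1 - s) * dist x y := by
  have := dist_geod_geod hX x y (s := s) (t := 1) hs ⟨zero_le_one, le_rfl⟩
  rwa [geod_one, abs_sub_comm, abs_of_nonneg (sub_nonneg.2 hs.2)] at this

lemma cmpPoint_mul {d s : ℝ} (x y : EuclideanSpace ℝ (Fin 2)) (h : dist x y = d) :
    cmpPoint d x y (s * d) = x + s • (y - x) := by
  rcases eq_or_ne d 0 with rfl | hd
  · rw [dist_eq_zero] at h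
    simp [cmpPoint, h]
  · rw [cmpPoint, mul_div_cancel_right₀ _ hd]

/-- The CAT(0) inequality in the form in which it is used below. -/
lemma dist_geod_geod_le_aux (hX : IsCAT0 X) (x y z : X) {s t : ℝ}
    (hs : s ∈ Set.Icc (0 : ℝ) 1) (ht : t ∈ Set.Icc (0 : ℝ) 1) :
    ∃ x' y' z' : EuclideanSpace ℝ (Fin 2), dist x' y' = dist x y ∧ dist x' z' = dist x z ∧
      dist y' z' = dist y z ∧
      dist (geod hX x y s) (geod hX x z t) ≤ dist (x' + s • (y' - x')) (x' + t • (z' - x')) := by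
  obtain ⟨x', y', z', h1, h2, h3⟩ := exists_comparison_triangle (dist y z) (dist x z)
    (dist x y) dist_nonneg dist_nonneg dist_nonneg
    (by linarith [dist_triangle_left y z x]) (by linarith [dist_triangle x y z])
    (by linarith [dist_triangle_right x y z])
  refine ⟨x', y', z', h1, h2, h3, ?_⟩
  have := hX.2 x y z _ _ (Classical.choose_spec (hX.1 x y)) (Classical.choose_spec (hX.1 x z))
    x' y' z' h1 h2 h3 _ (mul_dist_mem_Icc hs) _ (mul_dist_mem_Icc ht)
  rwa [cmpPoint_mul _ _ h1, cmpPoint_mul _ _ h2] at this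

lemma dist_geod_geod_same_left (hX : IsCAT0 X) (x y z : X) {s : ℝ}
    (hs : s ∈ Set.Icc (0 : ℝ) 1) :
    dist (geod hX x y s) (geod hX x z s) ≤ s * dist y z := by
  obtain ⟨x', y', z', h1, h2, h3, h⟩ := dist_geod_geod_le_aux hX x y z hs hs
  refine h.trans_eq ?_
  rw [dist_add_left, dist_smul₀, dist_sub_right, h3, Real.norm_of_nonneg hs.1]

/-- The Bruhat–Tits (CN) inequality. -/
lemma sq_dist_geod_le (hX : IsCAT0 X) (p x y : X) {s : ℝ} (hs : s ∈ Set.Icc (0 : ℝ) 1) :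
    dist p (geod hX x y s) ^ 2 ≤
      (1 - s) * dist p x ^ 2 + s * dist p y ^ 2 - s * (1 - s) * dist x y ^ 2 := by
  obtain ⟨x', y', p', h1, h2, h3, h⟩ := dist_geod_geod_le_aux hX x y p hs
    (t := 1) ⟨zero_le_one, le_rfl⟩
  rw [geod_one, dist_comm, one_smul, add_sub_cancel] at h
  have h' := pow_le_pow_left₀ dist_nonneg h 2
  refine h'.trans_eq ?_
  rw [dist_comm p x, dist_comm p y, ← h1, ← h2, ← h3, dist_eq_norm, dist_eq_norm, dist_eq_norm,
    dist_eq_norm]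
  have e : x' + s • (y' - x') - p' = (1 - s) • (x' - p') + s • (y' - p') := by module
  have e2 : x' - y' = (x' - p') - (y' - p') := by abel
  rw [e, e2, norm_add_sq_real, norm_sub_sq_real (x' - p') (y' - p'), norm_smul, norm_smul, inner_smul_left,
    inner_smul_right]
  simp only [mul_pow, Real.norm_eq_abs, sq_abs, conj_trivial]
  ring

/-- Uniqueness of geodesics. -/
lemma eq_geod (hX : IsCAT0 X) {x y m : X} {s : ℝ} (hs : s ∈ Set.Icc (0 : ℝ) 1)
    (h1 : dist x m ≤ s * dist x y) (h2 : dist m y ≤ (1 - s) * dist x y) :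
    m = geod hX x y s := by
  have h := sq_dist_geod_le hX m x y hs
  rw [dist_comm m x] at h
  have a1 := pow_le_pow_left₀ dist_nonneg h1 2
  have a2 := pow_le_pow_left₀ dist_nonneg h2 2
  have b1 := mul_le_mul_of_nonneg_left a1 (sub_nonneg.2 hs.2)
  have b2 := mul_le_mul_of_nonneg_left a2 hs.1
  have : dist m (geod hX x y s) ^ 2 ≤ 0 := by nlinarith
  exact dist_eq_zero.1 (pow_eq_zero_iff two_ne_zero |>.1 (le_antisymm this (sq_nonneg _)))

lemma geod_symm (hX : IsCAT0 X) (x y : X) {s : ℝ} (hs : s ∈ Set.Icc (0 : ℝ) 1) :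
    geod hX x y s = geod hX y x (1 - s) := by
  refine eq_geod hX ⟨by linarith [hs.2], by linarith [hs.1]⟩ ?_ ?_
  · rw [dist_comm, dist_geod_right hX x y hs, dist_comm y x]
  · rw [dist_comm, dist_left_geod hX x y hs, dist_comm y x, sub_sub_cancel]

lemma map_geod (hX : IsCAT0 X) (g : X ≃ᵢ X) (x y : X) {s : ℝ} (hs : s ∈ Set.Icc (0 : ℝ) 1) :
    g (geod hX x y s) = geod hX (g x) (g y) s := by
  refine eq_geod hX hs ?_ ?_
  · rw [g.dist_eq, g.dist_eq, dist_left_geod hX x y hs]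
  · rw [g.dist_eq, g.dist_eq, dist_geod_right hX x y hs]

lemma dist_geod_geod_same_right (hX : IsCAT0 X) (x y z : X) {s : ℝ}
    (hs : s ∈ Set.Icc (0 : ℝ) 1) :
    dist (geod hX x z s) (geod hX y z s) ≤ (1 - s) * dist x y := by
  rw [geod_symm hX x z hs, geod_symm hX y z hs]
  exact dist_geod_geod_same_left hX z x y ⟨by linarith [hs.2], by linarith [hs.1]⟩

/-- Convexity of the metric. -/
lemma dist_geod_geod_le (hX : IsCAT0 X) (x y x' y' : X) {s : ℝ}
    (hs : s ∈ Set.Icc (0 : ℝ) 1) :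
    dist (geod hX x y s) (geod hX x' y' s) ≤ (1 - s) * dist x x' + s * dist y y' := by
  have h1 := dist_geod_geod_same_left hX x y y' hs
  have h2 := dist_geod_geod_same_right hX x x' y' hs
  linarith [dist_triangle (geod hX x y s) (geod hX x y' s) (geod hX x' y' s)]

/-- The quadrilateral inequality. -/
lemma sq_dist_add_sq_dist_le (hX : IsCAT0 X) (a b c d : X) :
    dist a c ^ 2 + dist b d ^ 2 ≤
      dist a b ^ 2 + dist b c ^ 2 + dist c d ^ 2 + dist d a ^ 2 := by
  have hs : (1 / 2 : ℝ) ∈ Set.Icc (0 : ℝ) 1 := by constructor <;> norm_num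
  have h1 := sq_dist_geod_le hX b a c hs
  have h2 := sq_dist_geod_le hX d a c hs
  have h3 := dist_triangle_right b d (geod hX a c (1 / 2))
  have h4 := pow_le_pow_left₀ dist_nonneg h3 2
  rw [dist_comm b a] at h1
  rw [dist_comm d c] at h2
  nlinarith [sq_nonneg (dist b (geod hX a c (1 / 2)) - dist d (geod hX a c (1 / 2)))]

end CAT0

section Translation

variable {X : Type*} [MetricSpace X]

lemma transLen_le (f : X → X) (v : X) : transLen f ≤ dist v (f v) :=
  csInf_le ⟨0, by rintro _ ⟨x, rfl⟩; exact dist_nonneg⟩ ⟨v, rfl⟩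

lemma transLen_nonneg (f : X → X) : 0 ≤ transLen f :=
  Real.sInf_nonneg (by rintro _ ⟨x, rfl⟩; exact dist_nonneg)

lemma dist_pow_le (g : X ≃ᵢ X) (v : X) (n : ℕ) :
    dist v ((g ^ n) v) ≤ n * dist v (g v) := by
  induction n with
  | zero => simp
  | succ n ih =>
    have h : dist ((g ^ n) v) ((g ^ (n + 1)) v) = dist v (g v) := by
      rw [pow_succ, IsometryEquiv.mul_apply, IsometryEquiv.dist_eq]
    have := dist_triangle v ((g ^ n) v) ((g ^ (n + 1)) v)
    push_cast
    linarith

lemma two_mul_le_dist_sq (hX : IsCAT0 X) (g : X ≃ᵢ X) {L : ℝ} (hL : ∀ v, L ≤ dist v (g v))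
    (v : X) : 2 * L ≤ dist v ((g ^ 2) v) := by
  have hs : (1 / 2 : ℝ) ∈ Set.Icc (0 : ℝ) 1 := by constructor <;> norm_num
  have h1 := hL (geod hX v (g v) (1 / 2))
  rw [map_geod hX g _ _ hs, geod_symm hX _ _ hs] at h1
  have h2 := dist_geod_geod_same_left hX (g v) v (g (g v)) hs
  norm_num at h1 h2
  rw [pow_two, IsometryEquiv.mul_apply]
  linarith

lemma two_pow_mul_le_dist (hX : IsCAT0 X) (g : X ≃ᵢ X) {L : ℝ} (hL : ∀ v, L ≤ dist v (g v))
    (k : ℕ) (v : X) : 2 ^ k * L ≤ dist v ((g ^ 2 ^ k) v) := by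
  induction k generalizing v with
  | zero => simpa using hL v
  | succ k ih =>
    have := two_mul_le_dist_sq hX (g ^ 2 ^ k) ih v
    rw [← pow_mul, ← pow_succ] at this
    rw [pow_succ]
    linarith

lemma dist_pow_eq (hX : IsCAT0 X) (g : X ≃ᵢ X) {y : X} (hy : y ∈ MinSet g) (n : ℕ) :
    dist y ((g ^ n) y) = n * transLen g := by
  have hy' : dist y (g y) = transLen g := hy
  refine le_antisymm (hy' ▸ dist_pow_le g y n) ?_
  have h1 := two_pow_mul_le_dist hX g (transLen_le g) n y
  have hn : n ≤ 2 ^ n := Nat.lt_two_pow_self.le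
  have h2 := dist_pow_le g ((g ^ n) y) (2 ^ n - n)
  rw [← IsometryEquiv.mul_apply, ← pow_add, Nat.sub_add_cancel hn, ← IsometryEquiv.mul_apply,
    ← pow_succ', pow_succ, IsometryEquiv.mul_apply, IsometryEquiv.dist_eq, hy',
    Nat.cast_sub hn] at h2
  have h3 := dist_triangle y ((g ^ n) y) ((g ^ 2 ^ n) y)
  push_cast at h2
  linarith

lemma dist_zpow_zpow (hX : IsCAT0 X) (g : X ≃ᵢ X) {y : X} (hy : y ∈ MinSet g) (p q : ℤ) :
    dist ((g ^ p) y) ((g ^ q) y) = |(p : ℝ) - q| * transLen g := by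
  wlog h : p ≤ q generalizing p q
  · rw [dist_comm, this q p (le_of_not_ge h), abs_sub_comm]
  obtain ⟨n, rfl⟩ := Int.le.dest h
  rw [zpow_add, IsometryEquiv.mul_apply, IsometryEquiv.dist_eq, zpow_natCast,
    dist_pow_eq hX g hy]
  simp

/-- A semi-simple root of an isometry `z` with a minimal point: its minimal points are minimal
for `z`, and the translation lengths are proportional. -/
lemma mem_minSet_pow (hX : IsCAT0 X) (g : X ≃ᵢ X) {y : X} (hy : y ∈ MinSet g) {n : ℕ}
    {u : X} (hu : u ∈ MinSet ⇑(g ^ n)) :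
    y ∈ MinSet ⇑(g ^ n) ∧ transLen ⇑(g ^ n) = n * transLen g := by
  have h1 := dist_pow_eq hX g hy n
  have h2 : n * transLen g ≤ transLen ⇑(g ^ n) := by
    by_contra! hlt
    obtain ⟨N, hN⟩ := exists_nat_gt (2 * dist y u / (n * transLen g - transLen ⇑(g ^ n)))
    rw [div_lt_iff₀ (by linarith)] at hN
    have h3 := dist_pow_eq hX g hy (n * N)
    have h4 := dist_pow_eq hX (g ^ n) hu N
    rw [pow_mul] at h3
    have h5 := dist_triangle y u (((g ^ n) ^ N) y)
    have h6 := dist_triangle u (((g ^ n) ^ N) u) (((g ^ n) ^ N) y)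
    rw [IsometryEquiv.dist_eq, dist_comm u y] at h6
    push_cast at h3
    nlinarith
  have h3 := transLen_le ⇑(g ^ n) y
  have h4 : transLen ⇑(g ^ n) = n * transLen g := le_antisymm (h1 ▸ h3) h2
  exact ⟨h1.trans h4.symm, h4⟩

/-- The flow along the axes of `z`, through the minimal points of `z`. -/
noncomputable def axisFlow (hX : IsCAT0 X) (z : X ≃ᵢ X) (y : X) (t : ℝ) : X :=
  (z ^ ⌊t / transLen z⌋) (geod hX y (z y) (Int.fract (t / transLen z)))

variable (hX : IsCAT0 X) (z : X ≃ᵢ X)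

lemma fract_mem_Icc (r : ℝ) : Int.fract r ∈ Set.Icc (0 : ℝ) 1 :=
  ⟨Int.fract_nonneg r, (Int.fract_lt_one r).le⟩

/-- The flow is the only way of moving along an isometrically embedded line translated
by `z`. -/
lemma axisFlow_line (hl : 0 < transLen z) {c : ℝ → X}
    (hc : ∀ s t, dist (c s) (c t) = |s - t|) (hz : ∀ t, z (c t) = c (t + transLen z))
    (s t : ℝ) : axisFlow hX z (c s) t = c (s + t) := by
  have hpow : ∀ (n : ℕ) (u : ℝ), (z ^ n) (c u) = c (u + n * transLen z) := by
    intro n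
    induction n with
    | zero => simp
    | succ n ih =>
      intro u
      rw [pow_succ', IsometryEquiv.mul_apply, ih, hz]
      congr 1
      push_cast
      ring
  have hzpow : ∀ (n : ℤ) (u : ℝ), (z ^ n) (c u) = c (u + n * transLen z) := by
    intro n u
    obtain ⟨n, rfl | rfl⟩ := n.eq_nat_or_neg
    · simpa using hpow n u
    · rw [zpow_neg, zpow_natCast]
      have := hpow n (u - n * transLen z)
      rw [sub_add_cancel] at this
      rw [← this, IsometryEquiv.inv_apply_self]
      simp [sub_eq_add_neg]
  have hg : geod hX (c s) (z (c s)) (Int.fract (t / transLen z)) =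
      c (s + Int.fract (t / transLen z) * transLen z) := by
    have hf := fract_mem_Icc (t / transLen z)
    have e : dist (c s) (z (c s)) = transLen z := by
      rw [hz, hc, sub_add_cancel_left, abs_neg, abs_of_pos hl]
    symm
    refine eq_geod hX hf (le_of_eq ?_) (le_of_eq ?_)
    · rw [e, hc, sub_add_cancel_left, abs_neg, abs_of_nonneg (mul_nonneg hf.1 hl.le)]
    · rw [e, hz, hc, abs_sub_comm, abs_of_nonneg]
      · ring
      · nlinarith [hf.2]
  rw [axisFlow, hg, hzpow]
  congr 1
  rw [add_assoc, ← add_mul, add_comm (Int.fract _), Int.floor_add_fract,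
    div_mul_cancel₀ _ hl.ne']

lemma dist_axisFlow (hl : 0 < transLen z) {y : X} (hy : y ∈ MinSet z) (s t : ℝ) :
    dist (axisFlow hX z y s) (axisFlow hX z y t) = |s - t| := by
  have hy' : dist y (z y) = transLen z := hy
  -- distances to the orbit points on both sides
  have hlow : ∀ t, dist ((z ^ ⌊t / transLen z⌋) y) (axisFlow hX z y t) =
      t - ⌊t / transLen z⌋ * transLen z := by
    intro t
    rw [axisFlow, IsometryEquiv.dist_eq, dist_left_geod hX _ _ (fract_mem_Icc _), hy',
      Int.fract, sub_mul, div_mul_cancel₀ _ hl.ne']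
  have hhigh : ∀ t, dist (axisFlow hX z y t) ((z ^ (⌊t / transLen z⌋ + 1)) y) =
      (⌊t / transLen z⌋ + 1) * transLen z - t := by
    intro t
    rw [axisFlow, zpow_add_one, IsometryEquiv.mul_apply, IsometryEquiv.dist_eq,
      dist_geod_right hX _ _ (fract_mem_Icc _), hy', Int.fract]
    field_simp
    ring
  have hle : ∀ s t, s ≤ t → dist (axisFlow hX z y s) (axisFlow hX z y t) ≤ t - s := by
    intro s t hst
    have hfl : ⌊s / transLen z⌋ ≤ ⌊t / transLen z⌋ := Int.floor_le_floor (by gcongr)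
    rcases hfl.eq_or_lt with h | h
    · refine le_of_eq ?_
      rw [axisFlow, axisFlow, h, IsometryEquiv.dist_eq,
        dist_geod_geod hX _ _ (fract_mem_Icc _) (fract_mem_Icc _), hy', Int.fract, Int.fract, h,
        abs_sub_comm, abs_of_nonneg]
      · field_simp
        ring
      · have : s / transLen z ≤ t / transLen z := by gcongr
        linarith
    · have h1 := hhigh s
      have h2 := hlow t
      have h3 := dist_zpow_zpow hX z hy (⌊s / transLen z⌋ + 1) ⌊t / transLen z⌋
      have h4 : ((⌊s / transLen z⌋ : ℝ) + 1) ≤ ⌊t / transLen z⌋ := by exact_mod_cast h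
      push_cast at h3
      rw [abs_sub_comm, abs_of_nonneg (by linarith)] at h3
      have h5 := dist_triangle4 (axisFlow hX z y s) ((z ^ (⌊s / transLen z⌋ + 1)) y)
        ((z ^ ⌊t / transLen z⌋) y) (axisFlow hX z y t)
      rw [h1, h2, h3] at h5
      linarith
  wlog hst : s ≤ t generalizing s t
  · rw [dist_comm, this t s (le_of_not_ge hst), abs_sub_comm]
  rw [abs_sub_comm, abs_of_nonneg (by linarith)]
  refine le_antisymm (hle s t hst) ?_
  have h1 := hlow s
  have h2 := hhigh t
  have h3 := dist_zpow_zpow hX z hy ⌊s / transLen z⌋ (⌊t / transLen z⌋ + 1)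
  have hfl : (⌊s / transLen z⌋ : ℝ) ≤ ⌊t / transLen z⌋ := by
    exact_mod_cast Int.floor_le_floor (by gcongr)
  push_cast at h3
  rw [abs_sub_comm, abs_of_nonneg (by linarith)] at h3
  have h5 := dist_triangle4 ((z ^ ⌊s / transLen z⌋) y) (axisFlow hX z y s)
    (axisFlow hX z y t) ((z ^ (⌊t / transLen z⌋ + 1)) y)
  rw [h1, h2, h3] at h5
  linarith

lemma axisFlow_zero (y : X) : axisFlow hX z y 0 = y := by
  simp [axisFlow, geod_zero]

lemma map_axisFlow (hl : 0 < transLen z) {y : X} (t : ℝ) :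
    z (axisFlow hX z y t) = axisFlow hX z y (t + transLen z) := by
  rw [axisFlow, axisFlow, add_div, div_self hl.ne', Int.fract_add_one, Int.floor_add_one,
    zpow_add_one, ← IsometryEquiv.mul_apply, ← (Commute.refl z).zpow_left _ |>.eq]

lemma axisFlow_add (hl : 0 < transLen z) {y : X} (hy : y ∈ MinSet z) (s t : ℝ) :
    axisFlow hX z (axisFlow hX z y s) t = axisFlow hX z y (s + t) :=
  axisFlow_line hX z hl (dist_axisFlow hX z hl hy) (map_axisFlow hX z hl) s t

lemma axisFlow_transLen (hl : 0 < transLen z) (y : X) :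
    axisFlow hX z y (transLen z) = z y := by
  have := map_axisFlow hX z hl (y := y) 0
  rw [axisFlow_zero, zero_add] at this
  exact this.symm

lemma axisFlow_mem_minSet (hl : 0 < transLen z) {y : X} (hy : y ∈ MinSet z) (t : ℝ) :
    axisFlow hX z y t ∈ MinSet z := by
  change dist _ _ = _
  rw [map_axisFlow hX z hl, dist_axisFlow hX z hl hy, sub_add_cancel_left, abs_neg,
    abs_of_pos hl]

lemma commute_axisFlow {g : X ≃ᵢ X} (hg : Commute g z) (y : X) (t : ℝ) :
    g (axisFlow hX z y t) = axisFlow hX z (g y) t := by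
  rw [axisFlow, axisFlow, ← IsometryEquiv.mul_apply, (hg.zpow_right _).eq,
    IsometryEquiv.mul_apply, map_geod hX g _ _ (fract_mem_Icc _), ← IsometryEquiv.mul_apply g z,
    hg.eq, IsometryEquiv.mul_apply]

lemma commute_mem_minSet {g : X ≃ᵢ X} (hg : Commute g z) {y : X} (hy : y ∈ MinSet z) :
    g y ∈ MinSet z := by
  have hy' : dist y (z y) = transLen z := hy
  change dist _ _ = _
  rw [← IsometryEquiv.mul_apply z g, ← hg.eq, IsometryEquiv.mul_apply, g.dist_eq, hy']

end Translation

section Splitting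

variable {X : Type*} [MetricSpace X]

lemma midpoint_convex_bounded {h : ℝ → ℝ} {M : ℝ} (hM : ∀ s, h s ≤ M)
    (hc : ∀ s u, 2 * h (s + u) ≤ h s + h (s + 2 * u)) (s u : ℝ) : h (s + u) ≤ h s := by
  by_contra! hlt
  have key : ∀ n : ℕ, h s + 2 ^ n * (h (s + u) - h s) ≤ h (s + 2 ^ n * u) := by
    intro n
    induction n with
    | zero => simp
    | succ n ih =>
      have := hc s (2 ^ n * u)
      rw [← mul_assoc, ← pow_succ'] at this
      rw [pow_succ]
      rw [pow_succ] at this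
      linarith
  obtain ⟨n, hn⟩ := pow_unbounded_of_one_lt ((M - h s) / (h (s + u) - h s))
    (one_lt_two (α := ℝ))
  rw [div_lt_iff₀ (by linarith)] at hn
  linarith [key n, hM (s + 2 ^ n * u)]

/-- A continuous solution of Jensen's functional equation is affine. -/
lemma jensen_affine {ψ : ℝ → ℝ} (hc : Continuous ψ)
    (h : ∀ t s, ψ (t + s) + ψ (t - s) = 2 * ψ t) (t : ℝ) :
    ψ t = ψ 0 + t * (ψ 1 - ψ 0) := by
  have hadd : ∀ s t, ψ (s + t) - ψ 0 = (ψ s - ψ 0) + (ψ t - ψ 0) := by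
    intro s t
    have h1 := h ((s + t) / 2) ((s - t) / 2)
    have h2 := h ((s + t) / 2) ((s + t) / 2)
    ring_nf at h1 h2 ⊢
    linarith
  let A : ℝ →+ ℝ := AddMonoidHom.mk' (fun t => ψ t - ψ 0) hadd
  have hA : Continuous A := by
    change Continuous fun t => ψ t - ψ 0
    fun_prop
  have := map_real_smul A hA t 1
  simp only [smul_eq_mul, mul_one] at this
  change ψ t - ψ 0 = t * (ψ 1 - ψ 0) at this
  linarith

/-- The signed height difference of two minimal points of `z`, along the axes of `z`. -/
noncomputable def height (z : X ≃ᵢ X) (x y : X) : ℝ :=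
  (dist x (z y) ^ 2 - dist x y ^ 2 - transLen z ^ 2) / (2 * transLen z)

/-- The distance between the axes of `z` through two minimal points of `z`. -/
noncomputable def axisDist (z : X ≃ᵢ X) (x y : X) : ℝ :=
  Real.sqrt (dist x y ^ 2 - height z x y ^ 2)

variable (hX : IsCAT0 X) {z : X ≃ᵢ X} (hl : 0 < transLen z)
include hX hl

lemma continuous_axisFlow {y : X} (hy : y ∈ MinSet z) : Continuous (axisFlow hX z y) :=
  (Isometry.of_dist_eq fun s t => by
    rw [dist_axisFlow hX z hl hy, Real.dist_eq]).continuous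

lemma axisFlow_eq_geod {y : X} (hy : y ∈ MinSet z) (s u : ℝ) :
    axisFlow hX z y (s + u) = geod hX (axisFlow hX z y s) (axisFlow hX z y (s + 2 * u))
      (1 / 2) := by
  refine eq_geod hX (by constructor <;> norm_num) (le_of_eq ?_) (le_of_eq ?_)
  · rw [dist_axisFlow hX z hl hy, dist_axisFlow hX z hl hy, sub_add_cancel_left,
      sub_add_cancel_left, abs_neg, abs_neg, abs_mul, abs_two]
    ring
  · rw [dist_axisFlow hX z hl hy, dist_axisFlow hX z hl hy, sub_add_cancel_left,
      abs_neg, abs_mul, abs_two, show s + u - (s + 2 * u) = -u by ring, abs_neg]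
    ring

lemma dist_axisFlow_shift {x y : X} (hx : x ∈ MinSet z) (hy : y ∈ MinSet z) (s t : ℝ) :
    dist (axisFlow hX z x s) (axisFlow hX z y t) = dist x (axisFlow hX z y (t - s)) := by
  have key : ∀ r u v : ℝ, dist (axisFlow hX z x (u + v)) (axisFlow hX z y (u + v + r)) ≤
      dist (axisFlow hX z x u) (axisFlow hX z y (u + r)) := by
    intro r
    refine midpoint_convex_bounded (M := dist x y + |r|)
      (h := fun u => dist (axisFlow hX z x u) (axisFlow hX z y (u + r))) ?_ ?_
    · intro u
      have h1 : dist (axisFlow hX z x u) (axisFlow hX z y u) ≤ dist x y := by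
        have hf := fract_mem_Icc (u / transLen z)
        have := dist_geod_geod_le hX x (z x) y (z y) hf
        rw [z.dist_eq] at this
        rw [axisFlow, axisFlow, IsometryEquiv.dist_eq]
        linarith
      have h2 := dist_axisFlow hX z hl hy u (u + r)
      rw [sub_add_cancel_left, abs_neg] at h2
      have := dist_triangle (axisFlow hX z x u) (axisFlow hX z y u) (axisFlow hX z y (u + r))
      linarith
    · intro u v
      have e : u + v + r = u + r + v := by ring
      have e' : u + 2 * v + r = u + r + 2 * v := by ring
      have := dist_geod_geod_le hX (axisFlow hX z x u) (axisFlow hX z x (u + 2 * v))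
        (axisFlow hX z y (u + r)) (axisFlow hX z y (u + r + 2 * v)) (s := 1 / 2)
        (by constructor <;> norm_num)
      simp only [e, e']
      rw [axisFlow_eq_geod hX hl hx, axisFlow_eq_geod hX hl hy]
      linarith
  have h1 := key (t - s) 0 s
  have h2 := key (t - s) s (-s)
  simp only [zero_add, add_sub_cancel, add_neg_cancel, axisFlow_zero] at h1 h2
  exact le_antisymm h1 h2

/-- The flat strip theorem. -/
lemma sq_dist_axisFlow {x y : X} (hx : x ∈ MinSet z) (hy : y ∈ MinSet z) (t : ℝ) :
    dist x (axisFlow hX z y t) ^ 2 = t ^ 2 + 2 * height z x y * t + dist x y ^ 2 := by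
  have hJ : ∀ t s : ℝ, (dist x (axisFlow hX z y (t + s)) ^ 2 - (t + s) ^ 2) +
      (dist x (axisFlow hX z y (t - s)) ^ 2 - (t - s) ^ 2) =
      2 * (dist x (axisFlow hX z y t) ^ 2 - t ^ 2) := by
    intro t s
    have h1 := sq_dist_geod_le hX x (axisFlow hX z y (t - s))
      (axisFlow hX z y (t - s + 2 * s)) (s := 1 / 2) (by constructor <;> norm_num)
    rw [← axisFlow_eq_geod hX hl hy, dist_axisFlow hX z hl hy, sub_add_cancel_left, sq_abs,
      sub_add_cancel, show t - s + 2 * s = t + s by ring] at h1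
    have h2 := sq_dist_add_sq_dist_le hX x (axisFlow hX z x s) (axisFlow hX z y (t + s))
      (axisFlow hX z y t)
    rw [dist_axisFlow_shift hX hl hx hy, dist_axisFlow_shift hX hl hx hy, add_sub_cancel_right,
      dist_axisFlow hX z hl hy, dist_comm _ x] at h2
    have h3 : dist x (axisFlow hX z x s) = |s| := by
      have := dist_axisFlow hX z hl hx 0 s
      rwa [axisFlow_zero, zero_sub, abs_neg] at this
    rw [h3, sq_abs, sq_abs] at h2
    nlinarith
  have hcont : Continuous fun t => dist x (axisFlow hX z y t) ^ 2 - t ^ 2 := by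
    have := continuous_axisFlow hX hl hy
    fun_prop
  have h := jensen_affine hcont hJ
  have h1 := h t
  have h2 := h (transLen z)
  simp only [axisFlow_zero, axisFlow_transLen hX z hl] at h1 h2
  set κ := dist x (axisFlow hX z y 1) ^ 2 - 1 ^ 2 - (dist x y ^ 2 - 0 ^ 2)
  have hκ : 2 * height z x y = κ := by
    rw [height]
    field_simp
    linarith
  rw [hκ]
  linarith

lemma axisDist_eq {x y : X} (hx : x ∈ MinSet z) (hy : y ∈ MinSet z) :
    axisDist z x y = dist x (axisFlow hX z y (-height z x y)) := by
  have h := sq_dist_axisFlow hX hl hx hy (-height z x y)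
  rw [axisDist, show dist x y ^ 2 - height z x y ^ 2 =
    dist x (axisFlow hX z y (-height z x y)) ^ 2 by linarith, Real.sqrt_sq dist_nonneg]

lemma sq_axisDist {x y : X} (hx : x ∈ MinSet z) (hy : y ∈ MinSet z) :
    axisDist z x y ^ 2 = dist x y ^ 2 - height z x y ^ 2 := by
  rw [axisDist_eq hX hl hx hy, sq_dist_axisFlow hX hl hx hy]
  ring

/-- The product decomposition of the metric on the minimal set of `z`. -/
lemma sq_dist_axisFlow_axisFlow {x y : X} (hx : x ∈ MinSet z) (hy : y ∈ MinSet z) (s t : ℝ) :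
    dist (axisFlow hX z x s) (axisFlow hX z y t) ^ 2 =
      axisDist z x y ^ 2 + (t - s + height z x y) ^ 2 := by
  rw [dist_axisFlow_shift hX hl hx hy, sq_dist_axisFlow hX hl hx hy, sq_axisDist hX hl hx hy]
  ring

lemma axisDist_le_dist_axisFlow {x y : X} (hx : x ∈ MinSet z) (hy : y ∈ MinSet z) (t : ℝ) :
    axisDist z x y ≤ dist x (axisFlow hX z y t) := by
  have h := sq_dist_axisFlow_axisFlow hX hl hx hy 0 t
  rw [axisFlow_zero] at h
  refine abs_le_of_sq_le_sq' ?_ dist_nonneg |>.2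
  nlinarith [sq_nonneg (t - 0 + height z x y)]

omit hX hl in
lemma axisDist_nonneg (x y : X) : 0 ≤ axisDist z x y := Real.sqrt_nonneg _

lemma height_symm {x y : X} (hx : x ∈ MinSet z) (hy : y ∈ MinSet z) :
    height z y x = -height z x y := by
  have h1 := sq_dist_axisFlow hX hl hy hx 1
  have h2 := sq_dist_axisFlow hX hl hx hy (-1)
  have h3 := dist_axisFlow_shift hX hl hx hy 1 0
  rw [axisFlow_zero, zero_sub, dist_comm] at h3
  rw [h3, h2, dist_comm y x] at h1
  linarith

lemma axisDist_symm {x y : X} (hx : x ∈ MinSet z) (hy : y ∈ MinSet z) :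
    axisDist z y x = axisDist z x y := by
  rw [axisDist, axisDist, height_symm hX hl hx hy, dist_comm, neg_sq]

omit hX hl in
lemma height_self {x : X} (hx : x ∈ MinSet z) : height z x x = 0 := by
  have hx' : dist x (z x) = transLen z := hx
  simp [height, hx']

omit hX hl in
lemma axisDist_self {x : X} (hx : x ∈ MinSet z) : axisDist z x x = 0 := by
  simp [axisDist, height_self hx]

lemma height_le_add {x y w : X} (hx : x ∈ MinSet z) (hy : y ∈ MinSet z) (hw : w ∈ MinSet z) :
    height z x w ≤ height z x y + height z y w := by
  by_contra! hlt
  set ε := height z x w - (height z x y + height z y w) with hε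
  set K := axisDist z x y ^ 2 + axisDist z y w ^ 2 with hK
  have hKn : 0 ≤ K := by positivity
  -- a point far up on the axes
  set t := 1 + |height z x y| + |height z y w| + 2 * (K / ε) with ht
  have hKε : 0 ≤ K / ε := div_nonneg hKn (by linarith)
  have hε0 : 0 < ε := by linarith
  have hmul : K / ε * ε = K := div_mul_cancel₀ _ hε0.ne'
  have bound : ∀ {p q : X}, p ∈ MinSet z → q ∈ MinSet z → axisDist z p q ^ 2 ≤ K →
      |height z p q| + 1 + 2 * (K / ε) ≤ t →
      dist p (axisFlow hX z q t) ≤ t + height z p q + ε / 3 ∧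
      t + height z p q ≤ dist p (axisFlow hX z q t) := by
    intro p q hp hq h1 h2
    have h3 := sq_dist_axisFlow_axisFlow hX hl hp hq 0 t
    rw [axisFlow_zero, sub_zero] at h3
    have h4 := neg_abs_le (height z p q)
    have h5 : 1 + 2 * (K / ε) ≤ t + height z p q := by linarith
    constructor
    · refine abs_le_of_sq_le_sq' ?_ (by linarith) |>.2
      rw [h3]
      nlinarith [mul_le_mul_of_nonneg_right h5 hε0.le]
    · refine abs_le_of_sq_le_sq' ?_ dist_nonneg |>.2
      rw [h3]
      nlinarith [sq_nonneg (axisDist z p q)]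
  have b1 := (bound hx hy (by nlinarith [sq_nonneg (axisDist z y w)])
    (by linarith [abs_nonneg (height z y w)])).1
  have b2 := (bound hy hw (by nlinarith [sq_nonneg (axisDist z x y)])
    (by linarith [abs_nonneg (height z x y)])).1
  have h1 := dist_axisFlow_shift hX hl hy hw t (2 * t)
  rw [show 2 * t - t = t by ring] at h1
  have h2 := dist_triangle x (axisFlow hX z y t) (axisFlow hX z w (2 * t))
  have h3 := sq_dist_axisFlow_axisFlow hX hl hx hw 0 (2 * t)
  rw [axisFlow_zero, sub_zero] at h3
  have h4 : 2 * t + height z x w ≤ dist x (axisFlow hX z w (2 * t)) := by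
    refine abs_le_of_sq_le_sq' ?_ dist_nonneg |>.2
    rw [h3]
    nlinarith [sq_nonneg (axisDist z x w)]
  linarith

lemma height_add {x y w : X} (hx : x ∈ MinSet z) (hy : y ∈ MinSet z) (hw : w ∈ MinSet z) :
    height z x y + height z y w = height z x w := by
  refine le_antisymm ?_ (height_le_add hX hl hx hy hw)
  have := height_le_add hX hl hw hy hx
  rw [height_symm hX hl hx hw, height_symm hX hl hy hw, height_symm hX hl hx hy] at this
  linarith

lemma axisDist_triangle {x y w : X} (hx : x ∈ MinSet z) (hy : y ∈ MinSet z)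
    (hw : w ∈ MinSet z) : axisDist z x w ≤ axisDist z x y + axisDist z y w := by
  have h := dist_triangle x (axisFlow hX z y (-height z x y)) (axisFlow hX z w (-height z x w))
  rw [dist_axisFlow_shift hX hl hy hw] at h
  have e : -height z x w - -height z x y = -height z y w := by
    linarith [height_add hX hl hx hy hw]
  rw [e, ← axisDist_eq hX hl hx hy, ← axisDist_eq hX hl hy hw, ← axisDist_eq hX hl hx hw] at h
  exact h

end Splitting

section Tree

variable {X : Type*} [MetricSpace X] (hX : IsCAT0 X)
include hX

lemma exists_eq_geod {x y m : X} (h : dist x m + dist m y = dist x y) :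
    ∃ s ∈ Set.Icc (0 : ℝ) 1, m = geod hX x y s := by
  rcases (dist_nonneg (x := x) (y := y)).eq_or_lt with h0 | h0
  · have : dist x m = 0 := by linarith [dist_nonneg (x := x) (y := m), dist_nonneg (x := m) (y := y)]
    exact ⟨0, by simp, by rw [geod_zero, dist_eq_zero.1 this]⟩
  · have hs : dist x m / dist x y ∈ Set.Icc (0 : ℝ) 1 :=
      ⟨by positivity, (div_le_one h0).2 (by linarith [dist_nonneg (x := m) (y := y)])⟩
    have e : dist x m / dist x y * dist x y = dist x m := div_mul_cancel₀ _ h0.ne'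
    exact ⟨_, hs, eq_geod hX hs e.ge (by rw [sub_mul, e]; linarith)⟩

lemma dist_eq_abs_of_between {x y m n : X} (hm : dist x m + dist m y = dist x y)
    (hn : dist x n + dist n y = dist x y) : dist m n = |dist x m - dist x n| := by
  obtain ⟨s, hs, rfl⟩ := exists_eq_geod hX hm
  obtain ⟨t, ht, rfl⟩ := exists_eq_geod hX hn
  rw [dist_geod_geod hX x y hs ht, dist_left_geod hX x y hs, dist_left_geod hX x y ht,
    ← sub_mul, abs_mul, abs_of_nonneg (dist_nonneg (x := x) (y := y))]

omit hX in
/-- `m` lies between each two of the points `x`, `y`, `w`. -/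
def IsMedian (x y w m : X) : Prop :=
  dist x m + dist m y = dist x y ∧ dist y m + dist m w = dist y w ∧
    dist x m + dist m w = dist x w

lemma four_point_of_isMedian {q u v w m n : X} (hm : IsMedian q w u m) (hn : IsMedian q w v n) :
    dist u v + dist w q ≤ max (dist u w + dist v q) (dist v w + dist u q) := by
  obtain ⟨a1, a2, a3⟩ := hm
  obtain ⟨b1, b2, b3⟩ := hn
  have h := dist_eq_abs_of_between hX a1 b1
  have h1 := dist_triangle4 u m n v
  rw [dist_comm u m] at h1
  rw [dist_comm w m] at a2
  rw [dist_comm w n] at b2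
  rw [dist_comm w q, dist_comm u w, dist_comm v q, dist_comm v w, dist_comm u q, le_max_iff]
  rcases abs_cases (dist q m - dist q n) with ⟨e, _⟩ | ⟨e, _⟩
  · right; linarith
  · left; linarith

lemma continuous_geod (x y : X) : Continuous fun s : unitInterval => geod hX x y s := by
  refine LipschitzWith.continuous (K := (dist x y).toNNReal) (.of_dist_le_mul fun s t => ?_)
  rw [dist_geod_geod hX x y s.2 t.2, Real.coe_toNNReal _ dist_nonneg, mul_comm]
  rfl

lemma continuous_geod_right (p : X) :
    Continuous fun y : X × unitInterval => geod hX p y.1 y.2 := by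
  refine continuous_prod_of_continuous_lipschitzWith _ 1
    (fun y => continuous_geod hX p y) fun s => .of_dist_le_mul fun y w => ?_
  have := dist_geod_geod_same_left hX p y w s.2
  have := mul_le_of_le_one_left (dist_nonneg (x := y) (y := w)) s.2.2
  simp only [NNReal.coe_one, one_mul]
  linarith

variable {z : X ≃ᵢ X}

lemma geod_mem_minSet {x y : X} (hx : x ∈ MinSet z) (hy : y ∈ MinSet z) {s : ℝ}
    (hs : s ∈ Set.Icc (0 : ℝ) 1) : geod hX x y s ∈ MinSet z := by
  have hx' : dist x (z x) = transLen z := hx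
  have hy' : dist y (z y) = transLen z := hy
  refine le_antisymm ?_ (transLen_le z _)
  have := dist_geod_geod_le hX x y (z x) (z y) hs
  rw [hx', hy'] at this
  rw [map_geod hX z x y hs]
  linarith

variable (hl : 0 < transLen z)
include hl

lemma height_axisFlow {x y : X} (hx : x ∈ MinSet z) (hy : y ∈ MinSet z) (s : ℝ) :
    height z x (axisFlow hX z y s) = height z x y + s := by
  have hs := axisFlow_mem_minSet hX z hl hy s
  have h0 := sq_dist_axisFlow hX hl hx hs 1
  have h1 := sq_dist_axisFlow hX hl hx hy s
  have h2 := sq_dist_axisFlow hX hl hx hy (s + 1)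
  rw [axisFlow_add hX z hl hy] at h0
  linarith

lemma axisDist_axisFlow {x y : X} (hx : x ∈ MinSet z) (hy : y ∈ MinSet z) (s : ℝ) :
    axisDist z x (axisFlow hX z y s) = axisDist z x y := by
  have hs := axisFlow_mem_minSet hX z hl hy s
  have h0 := sq_axisDist hX hl hx hs
  have h1 := sq_dist_axisFlow_axisFlow hX hl hx hy 0 s
  rw [axisFlow_zero] at h1
  rw [height_axisFlow hX hl hx hy, h1] at h0
  refine (sq_eq_sq₀ (axisDist_nonneg _ _) (axisDist_nonneg _ _)).1 ?_
  rw [h0]; ring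

lemma axisDist_axisFlow_left {x y : X} (hx : x ∈ MinSet z) (hy : y ∈ MinSet z) (s : ℝ) :
    axisDist z (axisFlow hX z x s) y = axisDist z x y := by
  rw [axisDist_symm hX hl hy (axisFlow_mem_minSet hX z hl hx s), axisDist_axisFlow hX hl hy hx,
    axisDist_symm hX hl hx hy]

lemma axisDist_le_dist {x y : X} (hx : x ∈ MinSet z) (hy : y ∈ MinSet z) :
    axisDist z x y ≤ dist x y := by
  simpa only [axisFlow_zero] using axisDist_le_dist_axisFlow hX hl hx hy 0

omit hX hl in
lemma axisDist_eq_dist {x y : X} (h : height z x y = 0) : axisDist z x y = dist x y := by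
  rw [axisDist, h]
  simp [Real.sqrt_sq dist_nonneg]

lemma height_geod {x y : X} (hx : x ∈ MinSet z) (hy : y ∈ MinSet z) (h : height z x y = 0)
    {s : ℝ} (hs : s ∈ Set.Icc (0 : ℝ) 1) : height z x (geod hX x y s) = 0 := by
  have hm := geod_mem_minSet hX hx hy hs
  have h1 := axisDist_triangle hX hl hx hm hy
  have h2 := axisDist_le_dist hX hl hx hm
  have h3 := axisDist_le_dist hX hl hm hy
  have h4 := sq_axisDist hX hl hx hm
  rw [axisDist_eq_dist h] at h1
  rw [dist_geod_right hX x y hs] at h3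
  rw [dist_left_geod hX x y hs] at h2 h4
  have h5 : axisDist z x (geod hX x y s) = s * dist x y := by linarith
  rw [h5] at h4
  nlinarith

lemma eq_of_axisFlow {p x y : X} {t : ℝ} (hp : p ∈ MinSet z) (hy : y ∈ MinSet z)
    (h : height z p y = 0) (hx : height z p x = 0) (e : axisFlow hX z y t = x) : x = y := by
  have := height_axisFlow hX hl hp hy t
  rw [e, h, hx, zero_add] at this
  rw [← e, ← this, axisFlow_zero]

omit hl in
lemma dist_add_dist_geod {x y : X} {s : ℝ} (hs : s ∈ Set.Icc (0 : ℝ) 1) :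
    dist x (geod hX x y s) + dist (geod hX x y s) y = dist x y := by
  rw [dist_left_geod hX x y hs, dist_geod_right hX x y hs]
  ring

lemma continuous_axisFlow_geod {p q r : X} (hp : p ∈ MinSet z) (hq : q ∈ MinSet z)
    (hr : r ∈ MinSet z) :
    Continuous fun v : unitInterval × unitInterval × unitInterval =>
      axisFlow hX z (geod hX p (geod hX q r v.1) (unitInterval.symm v.2.1)) v.2.2 := by
  have hmem : ∀ v : unitInterval × unitInterval × unitInterval,
      geod hX p (geod hX q r v.1) (unitInterval.symm v.2.1) ∈ MinSet z := fun v =>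
    geod_mem_minSet hX hp (geod_mem_minSet hX hq hr v.1.2) (unitInterval.symm v.2.1).2
  have h1 : Continuous fun v : MinSet z × ℝ => axisFlow hX z v.1 v.2 :=
    continuous_prod_of_continuous_lipschitzWith _ 1
      (fun y => continuous_axisFlow hX hl y.2) fun s => .of_dist_le_mul fun y w => by
        rw [dist_axisFlow_shift hX hl y.2 w.2, sub_self, axisFlow_zero]
        simp [Subtype.dist_eq]
  have h2 : Continuous fun v : unitInterval × unitInterval × unitInterval =>
      (geod hX q r v.1, unitInterval.symm v.2.1) :=
    ((continuous_geod hX q r).comp continuous_fst).prodMk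
      (unitInterval.continuous_symm.comp (continuous_fst.comp continuous_snd))
  have h3 := (continuous_geod_right hX p).comp h2
  have h4 : Continuous fun v : unitInterval × unitInterval × unitInterval => (v.2.2 : ℝ) :=
    continuous_subtype_val.comp (continuous_snd.comp continuous_snd)
  exact h1.comp ((h3.subtype_mk hmem).prodMk h4)

/-- In a horizontal slice of the minimal set of `z` geodesic triangles are tripods, as
otherwise the product of a triangle with an interval would have dimension three. -/
lemma exists_isMedian (hdim : CovDimLE X 2) {p q r : X} (hp : p ∈ MinSet z) (hq : q ∈ MinSet z)
    (hr : r ∈ MinSet z) (hpq : height z p q = 0) (hpr : height z p r = 0) :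
    ∃ m ∈ MinSet z, IsMedian p q r m := by
  have hqr : height z q r = 0 := by
    have := height_add hX hl hp hq hr
    linarith
  have hmem : ∀ t : unitInterval, geod hX q r t ∈ MinSet z := fun t =>
    geod_mem_minSet hX hq hr t.2
  have hmem' : ∀ t u : unitInterval, geod hX p (geod hX q r t) u ∈ MinSet z := fun t u =>
    geod_mem_minSet hX hp (hmem t) u.2
  have hh : ∀ t : unitInterval, height z p (geod hX q r t) = 0 := fun t => by
    rw [← height_add hX hl hp hq (hmem t), hpq, height_geod hX hl hq hr hqr t.2, zero_add]
  have hh' : ∀ t u : unitInterval, height z p (geod hX p (geod hX q r t) u) = 0 := fun t u =>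
    height_geod hX hl hp (hmem t) (hh t) u.2
  let f : unitInterval × unitInterval × unitInterval → X := fun v =>
    axisFlow hX z (geod hX p (geod hX q r v.1) (unitInterval.symm v.2.1)) v.2.2
  have hf : Continuous f := continuous_axisFlow_geod hX hl hp hq hr
  obtain ⟨x, hx⟩ := hdim.exists_mem_image_cubeFacet f hf
  obtain ⟨⟨t0, u0, h0⟩, c0, e0⟩ := hx 0
  obtain ⟨⟨t1, u1, h1⟩, c1, e1⟩ := hx 1
  obtain ⟨⟨t2, u2, h2⟩, c2, e2⟩ := hx 2
  obtain ⟨⟨t3, u3, h3⟩, c3, e3⟩ := hx 3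
  simp [cubeFacet] at c0 c1 c2 c3
  subst c1 c2 c3
  rw [show f (t3, u3, 0) = _ from axisFlow_zero hX z _] at e3
  have hxm : x ∈ MinSet z := by rw [← e3]; exact hmem' t3 _
  have hx0 : height z p x = 0 := by rw [← e3]; exact hh' t3 _
  have key : ∀ t u h, f (t, u, h) = x → x = geod hX p (geod hX q r t) (unitInterval.symm u) :=
    fun t u h e => eq_of_axisFlow hX hl hp (hmem' t _) (hh' t _) hx0 e
  replace e1 := key 0 u1 h1 e1
  replace e2 := key t2 0 h2 e2
  rw [Set.Icc.coe_zero, geod_zero] at e1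
  rw [unitInterval.symm_zero, Set.Icc.coe_one, geod_one] at e2
  refine ⟨x, hxm, ?_, ?_, ?_⟩
  · rw [e1]
    exact dist_add_dist_geod hX (unitInterval.symm u1).2
  · rw [e2]
    exact dist_add_dist_geod hX t2.2
  · rcases c0 with rfl | rfl | rfl
    · replace e0 := key 1 u0 h0 e0
      rw [Set.Icc.coe_one, geod_one] at e0
      rw [e0]
      exact dist_add_dist_geod hX (unitInterval.symm u0).2
    · replace e0 := key t0 1 h0 e0
      rw [unitInterval.symm_one, Set.Icc.coe_zero, geod_zero] at e0
      simp [e0]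
    · have := height_axisFlow hX hl hp (hmem' t0 (unitInterval.symm u0)) ((1 : unitInterval) : ℝ)
      rw [show axisFlow hX z (geod hX p (geod hX q r t0) (unitInterval.symm u0))
        (1 : unitInterval) = x from e0, hx0, hh' t0 (unitInterval.symm u0)] at this
      simp at this

/-- A pseudo-metric satisfying the four-point condition in which all triples have medians. -/
structure IsPseudoTree {T : Type*} (D : T → T → ℝ) : Prop where
  self : ∀ u, D u u = 0
  symm : ∀ u v, D u v = D v u
  four_point : ∀ u v w q, D u v + D w q ≤ max (D u w + D v q) (D v w + D u q)
  median : ∀ u v w, ∃ m, D u m + D m v = D u v ∧ D v m + D m w = D v w ∧ D u m + D m w = D u w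

/-- The space of axes of `z` is a tree. -/
lemma isPseudoTree_axisDist (hdim : CovDimLE X 2) :
    IsPseudoTree fun u v : MinSet z => axisDist z (u : X) v := by
  have proj : ∀ q u : MinSet z, axisFlow hX z u (-height z q u) ∈ MinSet z ∧
      height z q (axisFlow hX z u (-height z q u)) = 0 := fun q u =>
    ⟨axisFlow_mem_minSet hX z hl u.2 _, by rw [height_axisFlow hX hl q.2 u.2]; ring⟩
  have h0 : ∀ {q u v : X}, q ∈ MinSet z → u ∈ MinSet z → v ∈ MinSet z → height z q u = 0 →
      height z q v = 0 → axisDist z u v = dist u v := fun hq hu hv h1 h2 => by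
    have := height_add hX hl hq hu hv
    exact axisDist_eq_dist (by linarith)
  refine ⟨fun u => axisDist_self u.2, fun u v => axisDist_symm hX hl v.2 u.2, ?_, ?_⟩
  · intro u v w q
    obtain ⟨hu, hu0⟩ := proj q u
    obtain ⟨hv, hv0⟩ := proj q v
    obtain ⟨hw, hw0⟩ := proj q w
    obtain ⟨m, -, hm⟩ := exists_isMedian hX hl hdim q.2 hw hu hw0 hu0
    obtain ⟨n, -, hn⟩ := exists_isMedian hX hl hdim q.2 hw hv hw0 hv0
    have h := four_point_of_isMedian hX hm hn
    have hq0 := height_self q.2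
    rw [← h0 q.2 hu hv hu0 hv0, ← h0 q.2 hu hw hu0 hw0, ← h0 q.2 hv hw hv0 hw0,
      ← h0 q.2 hu q.2 hu0 hq0, ← h0 q.2 hv q.2 hv0 hq0, ← h0 q.2 hw q.2 hw0 hq0] at h
    simpa only [axisDist_axisFlow hX hl, axisDist_axisFlow_left hX hl, u.2, v.2, w.2, q.2, hu, hv,
      hw] using h
  · intro q v w
    obtain ⟨hv, hv0⟩ := proj q v
    obtain ⟨hw, hw0⟩ := proj q w
    obtain ⟨m, hm, h1, h2, h3⟩ := exists_isMedian hX hl hdim q.2 hv hw hv0 hw0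
    have hq0 := height_self q.2
    have hm0 : height z q m = 0 := by
      obtain ⟨s, hs, rfl⟩ := exists_eq_geod hX h1
      exact height_geod hX hl q.2 hv hv0 hs
    rw [← h0 q.2 q.2 hm hq0 hm0, ← h0 q.2 hm hv hm0 hv0, ← h0 q.2 q.2 hv hq0 hv0] at h1
    rw [← h0 q.2 hv hm hv0 hm0, ← h0 q.2 hm hw hm0 hw0, ← h0 q.2 hv hw hv0 hw0] at h2
    rw [← h0 q.2 q.2 hm hq0 hm0, ← h0 q.2 hm hw hm0 hw0, ← h0 q.2 q.2 hw hq0 hw0] at h3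
    simp only [axisDist_axisFlow hX hl, axisDist_axisFlow_left hX hl, v.2, w.2, q.2, hv,
      hm] at h1 h2 h3
    exact ⟨⟨m, hm⟩, h1, h2, h3⟩

end Tree

section TreeDynamics

namespace IsPseudoTree

variable {T : Type*} {D : T → T → ℝ} (hD : IsPseudoTree D)
include hD

lemma triangle (u v w : T) : D u w ≤ D u v + D v w := by
  have := hD.four_point u w v v
  rwa [hD.self, add_zero, hD.symm w v, add_comm (D v w), max_self] at this

lemma nonneg (u v : T) : 0 ≤ D u v := by
  have := hD.triangle u v u
  rw [hD.self, hD.symm v u] at this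
  linarith

lemma congr_left {u v : T} (h : D u v = 0) (w : T) : D u w = D v w := by
  have h1 := hD.triangle u v w
  have h2 := hD.triangle v u w
  rw [hD.symm v u] at h2
  linarith

lemma congr_right {u v : T} (h : D u v = 0) (w : T) : D w u = D w v := by
  rw [hD.symm w u, hD.symm w v, hD.congr_left h]

lemma eq_zero_of_between {u v m n : T} (hm : D u m + D m v = D u v) (hn : D u n + D n v = D u v)
    (h : D u m = D u n) : D m n = 0 := by
  refine le_antisymm ?_ (hD.nonneg _ _)
  have := hD.four_point m n u v
  rw [hD.symm m u, hD.symm n u] at this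
  rcases le_max_iff.1 this with h | h <;> linarith

/-- A point `u` is moved by an elliptic isometry by twice its distance to the fixed tree. -/
lemma exists_fixed_between {g : T → T} (hg : ∀ u v, D (g u) (g v) = D u v) {c : T}
    (hc : D c (g c) = 0) (u : T) :
    ∃ m, D m (g m) = 0 ∧ D c m + D m u = D c u ∧ D u (g u) = 2 * D m u := by
  obtain ⟨m, h1, h2, h3⟩ := hD.median c u (g u)
  have e : D c (g u) = D c u := by rw [hD.congr_left hc, hg]
  have h4 : D c (g m) = D c m := by rw [hD.congr_left hc, hg]
  refine ⟨m, hD.eq_zero_of_between h3 ?_ h4.symm, h1, ?_⟩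
  · rw [h4, hg, e, h1]
  · rw [hD.symm u m] at h2
    linarith

/-- The fixed trees of two elliptic isometries are joined by a bridge, each isometry moving
the endpoint fixed by the other one by twice the length of the bridge. -/
lemma exists_bridge {g h : T → T} (hg : ∀ u v, D (g u) (g v) = D u v)
    (hh : ∀ u v, D (h u) (h v) = D u v) {q₀ p₀ : T} (hq : D q₀ (g q₀) = 0)
    (hp : D p₀ (h p₀) = 0) :
    ∃ p q, D q (g q) = 0 ∧ D p (h p) = 0 ∧ D p (g p) = 2 * D p q ∧ D q (h q) = 2 * D p q := by
  obtain ⟨q, hq1, -, hq3⟩ := hD.exists_fixed_between hg hq p₀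
  obtain ⟨p, hp1, hp2, hp3⟩ := hD.exists_fixed_between hh hp q
  refine ⟨p, q, hq1, hp1, le_antisymm ?_ ?_, hp3⟩
  · have h1 := hD.triangle p q (g p)
    rw [hD.congr_left hq1 (g p), hg, hD.symm q p] at h1
    linarith
  · have h1 := hD.triangle p₀ p (g p₀)
    have h2 := hD.triangle p (g p) (g p₀)
    rw [hg, hD.symm p p₀] at h2
    rw [hD.symm q p₀] at hq3
    linarith

variable {g h : T → T} (hg : ∀ u v, D (g u) (g v) = D u v) (hh : ∀ u v, D (h u) (h v) = D u v)
  (hinv : ∀ u, D (h (h u)) u = 0) {p q : T} (hq : D q (g q) = 0) (hp : D p (h p) = 0)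
  (hgp : D p (g p) = 2 * D p q)
include hg hh hinv hq hp hgp

omit hg hq hp hgp in
lemma dist_involution (u v : T) : D (h u) v = D u (h v) := by
  rw [← hh, hD.congr_left (hinv u)]

lemma between_or {s : ℝ} {y u : T} (hu : D u q = D y q) (h1 : D u (h y) ≤ s)
    (h2 : D (g u) (h y) ≤ s) :
    D y q + D y (h q) ≤ s ∨ D p q + D y (h q) ≤ D y p := by
  have hpy : D (h y) p = D y p := by rw [hD.congr_right hp, hh]
  have hgq : ∀ v, D (g v) q = D v q := fun v => by rw [hD.congr_right hq, hg]
  obtain ⟨v, hv1, hv2, hv3⟩ : ∃ v, D v q = D y q ∧ D v (h y) ≤ s ∧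
      D p q + D v q ≤ D v p := by
    have := hD.four_point (g u) q p (g p)
    rw [hg, hD.symm q (g p), hgq, hgq, hD.symm q p, hgp] at this
    rcases le_max_iff.1 this with h3 | h3
    · exact ⟨g u, by rw [hgq, hu], h2, by rw [hgq]; linarith⟩
    · exact ⟨u, hu, h1, by linarith⟩
  have := hD.four_point v p (h y) q
  rw [hD.symm p (h y), hpy, hD.dist_involution hh hinv] at this
  rcases le_max_iff.1 this with h3 | h3
  · left; linarith
  · right; linarith

/-- The displacement of the product of an elliptic isometry and an involution of a tree is at
least twice the length of the bridge, and bounds the distances to the endpoints of a segment. -/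
lemma add_le_of_le (hr : 0 < D p q) {s : ℝ} {y u v : T} (hu : D u q = D y q)
    (h1 : D u (h y) ≤ s) (h2 : D (g u) (h y) ≤ s) (hv : D v q = D (h y) q)
    (h3 : D v (h (h y)) ≤ s) (h4 : D (g v) (h (h y)) ≤ s) (hhq : D q (h q) = 2 * D p q) :
    D y q + D y (h q) ≤ s := by
  have hpy : D (h y) p = D y p := by rw [hD.congr_right hp, hh]
  rcases hD.between_or hg hh hinv hq hp hgp hu h1 h2 with h5 | h5
  · exact h5
  rcases hD.between_or hg hh hinv hq hp hgp hv h3 h4 with h6 | h6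
  · rw [hh, hD.dist_involution hh hinv] at h6
    linarith
  · rw [hh, hpy] at h6
    have h7 := hD.four_point q (h q) y p
    have h8 : D (h q) p = D p q := by rw [hD.congr_right hp, hh, hD.symm]
    rw [hhq, hD.symm q y, hD.symm (h q) y, hD.symm q p, h8] at h7
    rcases le_max_iff.1 h7 with h9 | h9 <;> linarith

end IsPseudoTree

end TreeDynamics

section Centralizer

variable {X : Type*} [MetricSpace X] (hX : IsCAT0 X) {z g : X ≃ᵢ X}

lemma height_map (hg : Commute g z) (x y : X) : height z (g x) (g y) = height z x y := by
  rw [height, height, ← IsometryEquiv.mul_apply, ← hg.eq, IsometryEquiv.mul_apply, g.dist_eq,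
    g.dist_eq]

lemma axisDist_map (hg : Commute g z) (x y : X) :
    axisDist z (g x) (g y) = axisDist z x y := by
  rw [axisDist, axisDist, height_map hg, g.dist_eq]

variable (hl : 0 < transLen z)
include hX hl

lemma height_shift_eq (hg : Commute g z) {x y : X} (hx : x ∈ MinSet z) (hy : y ∈ MinSet z) :
    height z x (g x) = height z y (g y) := by
  have hgx := commute_mem_minSet z hg hx
  have hgy := commute_mem_minSet z hg hy
  have h1 := height_add hX hl hx hgx hgy
  have h2 := height_add hX hl hx hy hgy
  rw [height_map hg] at h1
  linarith

lemma height_mul {h : X ≃ᵢ X} (hg : Commute g z) (hh : Commute h z) {y : X}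
    (hy : y ∈ MinSet z) :
    height z y ((g * h) y) = height z y (g y) + height z y (h y) := by
  have hhy := commute_mem_minSet z hh hy
  rw [IsometryEquiv.mul_apply, ← height_add hX hl hy hhy (commute_mem_minSet z hg hhy),
    height_shift_eq hX hl hg hhy hy, add_comm]

lemma height_pow (hg : Commute g z) {y : X} (hy : y ∈ MinSet z) (n : ℕ) :
    height z y ((g ^ n) y) = n * height z y (g y) := by
  induction n with
  | zero => simp [height_self hy]
  | succ n ih =>
    rw [pow_succ, height_mul hX hl (hg.pow_left n) hg hy, ih]
    push_cast
    ring

lemma height_apply_self {y : X} (hy : y ∈ MinSet z) : height z y (z y) = transLen z := by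
  have := height_axisFlow hX hl hy hy (transLen z)
  rwa [axisFlow_transLen hX z hl, height_self hy, zero_add] at this

lemma axisDist_apply_self {x y : X} (hx : x ∈ MinSet z) (hy : y ∈ MinSet z) :
    axisDist z x (z y) = axisDist z x y := by
  rw [← axisFlow_transLen hX z hl, axisDist_axisFlow hX hl hx hy]

lemma eq_axisFlow {x y : X} (hx : x ∈ MinSet z) (hy : y ∈ MinSet z) (h : axisDist z x y = 0) :
    y = axisFlow hX z x (height z x y) := by
  rw [axisDist_eq hX hl hx hy] at h
  rw [dist_eq_zero.1 h, axisFlow_add hX z hl hy, ← dist_eq_zero.1 h, neg_add_cancel,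
    axisFlow_zero]

lemma map_axisFlow_of_axisDist_eq_zero (hg : Commute g z) {x y : X} (hx : x ∈ MinSet z)
    (hy : y ∈ MinSet z) (h : axisDist z x (g y) = 0) (t : ℝ) :
    g (axisFlow hX z y t) = axisFlow hX z x (height z x (g y) + t) := by
  rw [commute_axisFlow hX z hg, eq_axisFlow hX hl hx (commute_mem_minSet z hg hy) h,
    axisFlow_add hX z hl hx, ← eq_axisFlow hX hl hx (commute_mem_minSet z hg hy) h]

lemma image_range_axisFlow (hg : Commute g z) {x y : X} (hx : x ∈ MinSet z)
    (hy : y ∈ MinSet z) (h : axisDist z x (g y) = 0) :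
    g '' Set.range (axisFlow hX z y) = Set.range (axisFlow hX z x) := by
  ext v
  constructor
  · rintro ⟨_, ⟨t, rfl⟩, rfl⟩
    exact ⟨_, (map_axisFlow_of_axisDist_eq_zero hX hl hg hx hy h t).symm⟩
  · rintro ⟨t, rfl⟩
    refine ⟨_, ⟨t - height z x (g y), rfl⟩, ?_⟩
    rw [map_axisFlow_of_axisDist_eq_zero hX hl hg hx hy h, add_sub_cancel]

lemma sq_dist_eq {x y : X} (hx : x ∈ MinSet z) (hy : y ∈ MinSet z) :
    dist x y ^ 2 = axisDist z x y ^ 2 + height z x y ^ 2 := by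
  rw [sq_axisDist hX hl hx hy]
  ring

lemma mem_minSet_iff_axisDist_le (hg : Commute g z) {y₀ y : X} (hy₀ : y₀ ∈ MinSet z)
    (hg₀ : y₀ ∈ MinSet g) (hy : y ∈ MinSet z) :
    y ∈ MinSet g ↔ axisDist z y (g y) ≤ axisDist z y₀ (g y₀) := by
  have hg₀' : dist y₀ (g y₀) = transLen g := hg₀
  have h1 := sq_dist_eq hX hl hy (commute_mem_minSet z hg hy)
  have h2 := sq_dist_eq hX hl hy₀ (commute_mem_minSet z hg hy₀)
  rw [height_shift_eq hX hl hg hy hy₀] at h1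
  have h3 := transLen_le g y
  rw [← abs_of_nonneg (axisDist_nonneg y (g y)), ← abs_of_nonneg (axisDist_nonneg y₀ (g y₀)),
    ← sq_le_sq]
  change dist y (g y) = transLen g ↔ _
  rw [← hg₀'] at h3 ⊢
  constructor
  · intro h
    rw [h] at h1
    linarith
  · intro h
    refine le_antisymm (abs_le_of_sq_le_sq' ?_ dist_nonneg).2 h3
    linarith

lemma axisDist_le_of_mem_minSet (hg : Commute g z) {y₀ y : X} (hy₀ : y₀ ∈ MinSet z)
    (hg₀ : y₀ ∈ MinSet g) (hy : y ∈ MinSet z) :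
    axisDist z y₀ (g y₀) ≤ axisDist z y (g y) := by
  by_contra! h
  have := (mem_minSet_iff_axisDist_le hX hl hg hy₀ hg₀ hy).2 h.le
  exact h.not_ge ((mem_minSet_iff_axisDist_le hX hl hg hy this hy₀).1 hg₀)

/-- A semi-simple root of `z` is elliptic on the space of axes of `z`. -/
lemma exists_axisDist_eq_zero {n : ℕ} (hn : n ≠ 0) (hgz : g ^ n = z) (hs : SemiSimple g)
    {u : X} (hu : u ∈ MinSet z) :
    ∃ y ∈ MinSet z, axisDist z y (g y) = 0 ∧ height z y (g y) = transLen g := by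
  subst hgz
  obtain ⟨y, hy⟩ := hs
  obtain ⟨hy1, hy2⟩ := mem_minSet_pow hX g hy hu
  have hc : Commute g (g ^ n) := (Commute.refl g).pow_right n
  have h1 := height_apply_self hX hl hy1
  rw [height_pow hX hl hc hy1, hy2] at h1
  have h2 := mul_left_cancel₀ (Nat.cast_ne_zero.2 hn) h1
  refine ⟨y, hy1, ?_, h2⟩
  rw [axisDist, h2, hy, sub_self, Real.sqrt_zero]

/-- The axis of `z` through a point which a root `g` of `z` moves along the axis is an axis
of `g`. -/
lemma isAxisOf_range_axisFlow {n : ℕ} (hn : n ≠ 0) (hgz : g ^ n = z) (hs : SemiSimple g)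
    {u : X} (hu : u ∈ MinSet z) (h : axisDist z u (g u) = 0) :
    IsAxisOf g (Set.range (axisFlow hX z u)) := by
  have hc : Commute g z := hgz ▸ (Commute.refl g).pow_right n
  obtain ⟨y, hy, -, hy2⟩ := exists_axisDist_eq_zero hX hl hn hgz hs hu
  refine ⟨axisFlow hX z u, dist_axisFlow hX z hl hu, rfl, fun t => ?_⟩
  rw [map_axisFlow_of_axisDist_eq_zero hX hl hc hu hu h, height_shift_eq hX hl hc hu hy, hy2,
    add_comm]

lemma axisDist_pow_eq_zero (hg : Commute g z) {y : X} (hy : y ∈ MinSet z)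
    (h : axisDist z y (g y) = 0) (n : ℕ) : axisDist z y ((g ^ n) y) = 0 := by
  induction n with
  | zero => simpa using axisDist_self hy
  | succ n ih =>
    have hn := commute_mem_minSet z (hg.pow_left n) hy
    refine le_antisymm ?_ (axisDist_nonneg _ _)
    have := axisDist_triangle hX hl hy hn (commute_mem_minSet z (hg.pow_left (n + 1)) hy)
    rwa [ih, pow_succ, IsometryEquiv.mul_apply, axisDist_map (hg.pow_left n), h,
      add_zero] at this

end Centralizer

section Band

section Relations

variable {G : Type*} [Group G] {a b d : G} {k : ℕ}

lemma garside_mul_left (h1 : (a * b) ^ k * a = d) (h2 : b * (a * b) ^ k = d) :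
    d * a = b * d := by
  rw [← h1, ← mul_assoc, h2, h1]

lemma garside_mul_right (h1 : (a * b) ^ k * a = d) (h2 : b * (a * b) ^ k = d) :
    d * b = a * d := by
  rw [← h2, ← mul_assoc a, ← pow_succ', pow_succ, ← mul_assoc, h1.trans h2.symm]

lemma garside_mul_eq_pow (h1 : (a * b) ^ k * a = d) : d * b = (a * b) ^ (k + 1) := by
  rw [← h1, pow_succ, mul_assoc]

lemma garside_sq (h1 : (a * b) ^ k * a = d) (h2 : b * (a * b) ^ k = d) :
    (a * b) ^ (2 * k + 1) = d ^ 2 := by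
  rw [pow_two, ← h2, ← mul_assoc, h2, garside_mul_eq_pow h1, ← pow_add]
  congr 1
  omega

lemma garside_mul_mul (h1 : (a * b) ^ k * a = d) (h2 : b * (a * b) ^ k = d) :
    b * a * d = d * (a * b) := by
  rw [mul_assoc, ← garside_mul_right h1 h2, ← mul_assoc, ← garside_mul_left h1 h2, mul_assoc]

lemma garside_sq' (h1 : (a * b) ^ k * a = d) (h2 : b * (a * b) ^ k = d) :
    (b * a) ^ (2 * k + 1) = d ^ 2 := by
  have h : b * a = d * (a * b) * d⁻¹ := eq_mul_inv_of_mul_eq (garside_mul_mul h1 h2)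
  rw [h, conj_pow, garside_sq h1 h2]
  group

lemma commute_garside_sq_left (h1 : (a * b) ^ k * a = d) (h2 : b * (a * b) ^ k = d) :
    Commute a (d ^ 2) := by
  rw [commute_iff_eq, pow_two, ← mul_assoc, ← garside_mul_right h1 h2, mul_assoc,
    ← garside_mul_left h1 h2, mul_assoc]

lemma commute_garside_sq_right (h1 : (a * b) ^ k * a = d) (h2 : b * (a * b) ^ k = d) :
    Commute b (d ^ 2) := by
  rw [commute_iff_eq, pow_two, ← mul_assoc, ← garside_mul_left h1 h2, mul_assoc,
    ← garside_mul_right h1 h2, mul_assoc]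

end Relations

variable {X : Type*} [MetricSpace X]

/-- The minimal set of `a` and `b` projects, in the tree of axes of `d ^ 2`, onto the segment
between a point fixed by `a * b` and its image under `d`. -/
lemma exists_band_endpoint (hX : IsCAT0 X) (hdim : CovDimLE X 2) {a b d z : X ≃ᵢ X} {k : ℕ}
    (h1 : (a * b) ^ k * a = d) (h2 : b * (a * b) ^ k = d) (hz : d ^ 2 = z)
    (hl : 0 < transLen z) (hsx : SemiSimple ⇑(a * b)) (hsd : SemiSimple d)
    (hfree : ∀ v, a v ≠ b v) {y₀ : X} (hya : y₀ ∈ MinSet a) (hyz : y₀ ∈ MinSet z)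
    (hyb : y₀ ∈ MinSet b) :
    ∃ q ∈ MinSet z, axisDist z q ((a * b) q) = 0 ∧ (q ∈ MinSet a ∧ q ∈ MinSet b) ∧
      (d q ∈ MinSet a ∧ d q ∈ MinSet b) ∧ ∀ y ∈ MinSet z, y ∈ MinSet a → y ∈ MinSet b →
        axisDist z y q + axisDist z y (d q) = axisDist z q (d q) := by
  have ca : Commute a z := hz ▸ commute_garside_sq_left h1 h2
  have cb : Commute b z := hz ▸ commute_garside_sq_right h1 h2
  have cx : Commute (a * b) z := ca.mul_left cb
  have cd : Commute d z := hz ▸ (Commute.refl d).pow_right 2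
  have cxk : Commute ((a * b) ^ k) z := cx.pow_left k
  have mem : ∀ {g : X ≃ᵢ X}, Commute g z → ∀ {y : X}, y ∈ MinSet z → g y ∈ MinSet z :=
    fun hg _ hy => commute_mem_minSet z hg hy
  have hxz : (a * b) ^ (2 * k + 1) = z := hz ▸ garside_sq h1 h2
  -- the displacements of `a` and `b` in terms of `a * b` and `d`
  have Da : ∀ y, axisDist z (((a * b) ^ k) y) (d y) = axisDist z y (a y) := fun y => by
    rw [← h1, IsometryEquiv.mul_apply, axisDist_map cxk]
  have Db : ∀ {y}, y ∈ MinSet z →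
      axisDist z ((a * b) (((a * b) ^ k) y)) (d y) = axisDist z y (b y) := fun {y} hy => by
    rw [← IsometryEquiv.mul_apply (a * b), ← pow_succ', ← garside_mul_eq_pow h1,
      IsometryEquiv.mul_apply, axisDist_map cd, axisDist_symm hX hl hy (mem cb hy)]
  have Dda : ∀ y, axisDist z (d y) (a (d y)) = axisDist z y (b y) := fun y => by
    rw [← IsometryEquiv.mul_apply a, ← garside_mul_right h1 h2, IsometryEquiv.mul_apply,
      axisDist_map cd]
  have Ddb : ∀ y, axisDist z (d y) (b (d y)) = axisDist z y (a y) := fun y => by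
    rw [← IsometryEquiv.mul_apply b, ← garside_mul_left h1 h2, IsometryEquiv.mul_apply,
      axisDist_map cd]
  have hdd : ∀ y, d (d y) = z y := fun y => by rw [← hz, pow_two, IsometryEquiv.mul_apply]
  -- the bridge between the fixed trees of `a * b` and `d`
  have hD := isPseudoTree_axisDist hX hl hdim
  set D : MinSet z → MinSet z → ℝ := fun u v => axisDist z (u : X) v with hDdef
  let x' : MinSet z → MinSet z := fun y => ⟨(a * b) y, mem cx y.2⟩
  let d' : MinSet z → MinSet z := fun y => ⟨d y, mem cd y.2⟩
  have hx' : ∀ u v, D (x' u) (x' v) = D u v := fun u v => axisDist_map cx _ _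
  have hd' : ∀ u v, D (d' u) (d' v) = D u v := fun u v => axisDist_map cd _ _
  have hinv : ∀ u, D (d' (d' u)) u = 0 := fun u => by
    rw [hD.symm]
    change axisDist z (u : X) (d (d u)) = 0
    rw [hdd, axisDist_apply_self hX hl u.2 u.2, axisDist_self u.2]
  obtain ⟨q₀, hq₀, hq₀', -⟩ := exists_axisDist_eq_zero hX hl (by omega) hxz hsx hyz
  obtain ⟨p₀, hp₀, hp₀', -⟩ := exists_axisDist_eq_zero hX hl two_ne_zero hz hsd hyz
  obtain ⟨p, q, hq, hp, hgp, hhq⟩ := hD.exists_bridge hx' hd' (q₀ := ⟨q₀, hq₀⟩)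
    (p₀ := ⟨p₀, hp₀⟩) hq₀' hp₀'
  have hxk : ∀ n : ℕ, axisDist z (q : X) (((a * b) ^ n) q) = 0 :=
    axisDist_pow_eq_zero hX hl cx q.2 hq
  have hxkq : ∀ (n : ℕ) (y : X), y ∈ MinSet z →
      axisDist z (((a * b) ^ n) y) q = axisDist z y q := fun n y hy => by
    have cn : Commute ((a * b) ^ n) z := cx.pow_left n
    have := hD.congr_right (u := q) (v := ⟨((a * b) ^ n) q, mem cn q.2⟩) (hxk n)
      ⟨((a * b) ^ n) y, mem cn hy⟩
    exact this.trans (axisDist_map cn _ _)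
  have qa : axisDist z (q : X) (a q) = axisDist z (q : X) (d q) := by
    rw [← Da]
    exact (hD.congr_left (u := q) (v := ⟨((a * b) ^ k) q, mem cxk q.2⟩) (hxk k) (d' q)).symm
  have qb : axisDist z (q : X) (b q) = axisDist z (q : X) (d q) := by
    rw [← Db q.2, ← IsometryEquiv.mul_apply (a * b), ← pow_succ']
    exact (hD.congr_left (u := q) (v := ⟨((a * b) ^ (k + 1)) q, mem (cx.pow_left _) q.2⟩)
      (hxk (k + 1)) (d' q)).symm
  -- the bridge has positive length, as otherwise `a` and `b` agree somewhere
  have hr : 0 < D p q := by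
    refine (hD.nonneg p q).lt_of_ne' fun h0 => ?_
    have hq0 : axisDist z (q : X) (d q) = 0 := by
      rw [h0, mul_zero] at hhq
      exact hhq
    have hab : height z (q : X) (a q) = height z (q : X) (b q) := by
      have e1 := height_mul hX hl ca cd q.2
      have e2 := height_mul hX hl cd cb q.2
      rw [garside_mul_right h1 h2] at e2
      linarith
    apply hfree q
    rw [eq_axisFlow hX hl q.2 (mem ca q.2) (qa.trans hq0), hab,
      ← eq_axisFlow hX hl q.2 (mem cb q.2) (qb.trans hq0)]
  -- the infima of the displacements of `a` and `b` agree
  have la : ∀ {y}, y ∈ MinSet z → axisDist z y₀ (a y₀) ≤ axisDist z y (a y) := fun hy =>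
    axisDist_le_of_mem_minSet hX hl ca hyz hya hy
  have lb : ∀ {y}, y ∈ MinSet z → axisDist z y₀ (b y₀) ≤ axisDist z y (b y) := fun hy =>
    axisDist_le_of_mem_minSet hX hl cb hyz hyb hy
  have hs : axisDist z y₀ (b y₀) = axisDist z y₀ (a y₀) :=
    le_antisymm ((lb (mem cd hyz)).trans (Ddb y₀).le) ((la (mem cd hyz)).trans (Dda y₀).le)
  have between : ∀ y ∈ MinSet z, y ∈ MinSet a → y ∈ MinSet b →
      axisDist z y q + axisDist z y (d q) ≤ axisDist z y₀ (a y₀) := by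
    intro y hy ha hb
    have ha' := (mem_minSet_iff_axisDist_le hX hl ca hyz hya hy).1 ha
    have hb' := (mem_minSet_iff_axisDist_le hX hl cb hyz hyb hy).1 hb
    rw [hs] at hb'
    refine hD.add_le_of_le hx' hd' hinv hq hp hgp hr (y := ⟨y, hy⟩)
      (u := ⟨((a * b) ^ k) y, mem cxk hy⟩) (v := ⟨((a * b) ^ k) (d y), mem cxk (mem cd hy)⟩)
      (hxkq k y hy) ((Da y).trans_le ha') ((Db hy).trans_le hb') (hxkq k (d y) (mem cd hy)) ?_ ?_
      hhq
    · exact ((Da (d y)).trans (Dda y)).trans_le hb'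
    · exact ((Db (mem cd hy)).trans (Ddb y)).trans_le ha'
  have hs2 : axisDist z y₀ (a y₀) = axisDist z (q : X) (d q) := by
    refine le_antisymm ((la q.2).trans qa.le) ?_
    have := axisDist_triangle hX hl q.2 hyz (mem cd q.2)
    rw [axisDist_symm hX hl hyz q.2] at this
    exact this.trans (between y₀ hyz hya hyb)
  refine ⟨q, q.2, hq, ⟨?_, ?_⟩, ⟨?_, ?_⟩, ?_⟩
  · rw [mem_minSet_iff_axisDist_le hX hl ca hyz hya q.2, qa, hs2]
  · rw [mem_minSet_iff_axisDist_le hX hl cb hyz hyb q.2, qb, hs, hs2]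
  · rw [mem_minSet_iff_axisDist_le hX hl ca hyz hya (mem cd q.2), Dda, qb, hs2]
  · rw [mem_minSet_iff_axisDist_le hX hl cb hyz hyb (mem cd q.2), Ddb, qa, hs, hs2]
  · intro y hy ha hb
    refine le_antisymm ((between y hy ha hb).trans hs2.le) ?_
    have := axisDist_triangle hX hl q.2 hy (mem cd q.2)
    rwa [axisDist_symm hX hl hy q.2] at this

end Band

section DihedralArtin

lemma map_altProd {G H F : Type*} [Monoid G] [Monoid H] [FunLike F G H] [MonoidHomClass F G H]
    (f : F) (x y : G) (n : ℕ) : f (altProd x y n) = altProd (f x) (f y) n := by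
  induction n generalizing x y with
  | zero => exact map_one f
  | succ n ih => exact (map_mul f _ _).trans (congrArg _ (ih y x))

lemma altProd_two_mul {G : Type*} [Monoid G] (x y : G) (k : ℕ) :
    altProd x y (2 * k) = (x * y) ^ k := by
  induction k with
  | zero => simp [altProd]
  | succ k ih =>
    rw [Nat.mul_succ, pow_succ', ← ih, mul_assoc]
    rfl

lemma altProd_two_mul_add_one {G : Type*} [Monoid G] (x y : G) (k : ℕ) :
    altProd x y (2 * k + 1) = x * (y * x) ^ k :=
  congrArg _ (altProd_two_mul y x k)

lemma altProd_of_eq (m : ℕ) :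
    altProd (PresentedGroup.of 0 : PresentedGroup (dihedralRel m)) (PresentedGroup.of 1) m =
      altProd (PresentedGroup.of 1) (PresentedGroup.of 0) m := by
  have h := PresentedGroup.one_of_mem (rels := dihedralRel m) rfl
  rw [map_mul, map_inv, mul_inv_eq_one, map_altProd, map_altProd] at h
  exact h

lemma exists_hom_dihedralArtin {G : Type*} [Group G] {m : ℕ} {x y : G}
    (h : altProd x y m = altProd y x m) :
    ∃ ψ : PresentedGroup (dihedralRel m) →* G,
      ψ (PresentedGroup.of 0) = x ∧ ψ (PresentedGroup.of 1) = y := by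
  have hr : ∀ r ∈ dihedralRel m, FreeGroup.lift ![x, y] r = 1 := by
    rintro _ rfl
    simp [map_altProd, h]
  exact ⟨PresentedGroup.toGroup hr, by simp, by simp⟩

lemma not_isOfFinOrder_garside_sq {m : ℕ} (hm : m ≠ 0) :
    ¬ IsOfFinOrder ((altProd (PresentedGroup.of 0 : PresentedGroup (dihedralRel m))
      (PresentedGroup.of 1) m) ^ 2) := by
  intro h
  obtain ⟨ψ, h0, h1⟩ := exists_hom_dihedralArtin (m := m) (x := Multiplicative.ofAdd (1 : ℤ)) rfl
  have hpow : ∀ (x : Multiplicative ℤ) (n : ℕ), altProd x x n = x ^ n := by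
    intro x n
    induction n with
    | zero => exact (pow_zero x).symm
    | succ n ih => rw [pow_succ', ← ih]; rfl
  have h2 := ψ.isOfFinOrder h
  rw [map_pow, map_altProd, h0, h1, hpow, ← pow_mul, isOfFinOrder_iff_pow_eq_one] at h2
  obtain ⟨n, hn, h3⟩ := h2
  rw [← pow_mul, ← ofAdd_nsmul] at h3
  have h4 := ofAdd_eq_one.1 h3
  simp [hm, hn.ne'] at h4

/-- The affine action of the dihedral Artin group on the complex plane shows that `b⁻¹ * a`,
which acts as a translation, has infinite order. -/
lemma not_isOfFinOrder_inv_mul {k : ℕ} (hk : k ≠ 0) :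
    ¬ IsOfFinOrder ((PresentedGroup.of 1 : PresentedGroup (dihedralRel (2 * k + 1)))⁻¹ *
      PresentedGroup.of 0) := by
  intro h
  have hη := Complex.isPrimitiveRoot_exp (2 * k + 1) (by omega)
  set η := Complex.exp (2 * Real.pi * Complex.I / (2 * k + 1 : ℕ)) with hη'
  have hη0 : η ≠ 0 := Complex.exp_ne_zero _
  let x : Equiv.Perm ℂ :=
    ⟨fun v => η * (1 - v), fun v => 1 - η⁻¹ * v, fun v => by field_simp; ring, fun v => by
      field_simp; ring⟩
  let y : Equiv.Perm ℂ :=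
    ⟨fun v => 1 - η * v, fun v => η⁻¹ * (1 - v), fun v => by field_simp; ring, fun v => by
      field_simp; ring⟩
  have hxy : ∀ (n : ℕ) v, ((x * y) ^ n) v = η ^ (2 * n) * v := by
    intro n
    induction n with
    | zero => simp
    | succ n ih =>
      intro v
      rw [pow_succ, Equiv.Perm.mul_apply, ih]
      change _ * (η * (1 - (1 - η * v))) = _
      ring
  have hrel : altProd x y (2 * k + 1) = altProd y x (2 * k + 1) := by
    have e : altProd x y (2 * k + 1) = (x * y) ^ k * x := by
      rw [altProd_two_mul_add_one, mul_pow_mul]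
    rw [e, altProd_two_mul_add_one]
    ext1 v
    rw [Equiv.Perm.mul_apply, Equiv.Perm.mul_apply, hxy, hxy]
    change η ^ (2 * k) * (η * (1 - v)) = 1 - η * (η ^ (2 * k) * v)
    have := hη.pow_eq_one
    rw [← mul_assoc, ← pow_succ, ← mul_assoc η, ← pow_succ', this]
    ring
  obtain ⟨ψ, h0, h1⟩ := exists_hom_dihedralArtin hrel
  have h2 := ψ.isOfFinOrder h
  rw [map_mul, map_inv, h0, h1, isOfFinOrder_iff_pow_eq_one] at h2
  obtain ⟨n, hn, h3⟩ := h2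
  have htr : ∀ (n : ℕ) v, ((y⁻¹ * x) ^ n) v = v + n * (η⁻¹ - 1) := by
    intro n
    induction n with
    | zero => simp
    | succ n ih =>
      intro v
      rw [pow_succ, Equiv.Perm.mul_apply, ih]
      change η⁻¹ * (1 - η * (1 - v)) + _ = _
      push_cast
      field_simp
      ring
  have h4 := htr n 0
  rw [h3, Equiv.Perm.one_apply, zero_add, eq_comm, mul_eq_zero, sub_eq_zero, inv_eq_one] at h4
  rcases h4 with h4 | h4
  · exact hn.ne' (by exact_mod_cast h4)
  · exact hη.ne_one (by omega) h4

lemma ProperlyDisc.isOfFinOrder {G X : Type*} [Group G] [MetricSpace X] {φ : G →* (X ≃ᵢ X)}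
    (hφ : ProperlyDisc φ) {g : G} {v : X} (hv : φ g v = v) : IsOfFinOrder g := by
  rw [← finite_zpowers]
  refine (hφ {v} isCompact_singleton).subset ?_
  let S : Subgroup G :=
    { carrier := {h | φ h v = v}
      mul_mem' := fun {h h'} hh hh' => by
        change φ (h * h') v = v
        rw [map_mul, IsometryEquiv.mul_apply, hh', hh]
      one_mem' := by
        change φ 1 v = v
        rw [map_one, IsometryEquiv.coe_one, id]
      inv_mem' := fun {h} hh => by
        change φ h⁻¹ v = v
        nth_rw 1 [← show φ h v = v from hh]
        rw [← IsometryEquiv.mul_apply, ← map_mul, inv_mul_cancel, map_one, IsometryEquiv.coe_one,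
          id] }
  have hS : Subgroup.zpowers g ≤ S := (Subgroup.zpowers_le).2 hv
  exact fun h hh => ⟨v, ⟨v, rfl, hS hh⟩, rfl⟩

end DihedralArtin

section Strip

variable {X : Type*} [MetricSpace X] (hX : IsCAT0 X) {z : X ≃ᵢ X} (hl : 0 < transLen z)

include hl in
lemma IsAxisOf.eq_range_axisFlow {L : Set X} (hL : IsAxisOf z L) {u : X} (hu : u ∈ L) :
    L = Set.range (axisFlow hX z u) := by
  obtain ⟨c, hc, rfl, hz⟩ := hL
  obtain ⟨t₀, rfl⟩ := hu
  have h := axisFlow_line hX z hl hc hz t₀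
  rw [funext h]
  exact ((add_left_surjective t₀).range_comp c).symm

include hX hl in
lemma axisDist_flatStrip {w : ℝ} {j : Set.Icc (0 : ℝ) w × ℝ → X} (hj : FlatStrip w j)
    (haxes : ∀ s, IsAxisOf z (Set.range fun t : ℝ => j (s, t))) (hmem : ∀ v, j v ∈ MinSet z)
    (s s' : Set.Icc (0 : ℝ) w) (t t' : ℝ) :
    axisDist z (j (s, t)) (j (s', t')) = |(s : ℝ) - s'| := by
  have h := (haxes s').eq_range_axisFlow hX hl (u := j (s', t')) ⟨t', rfl⟩
  refine le_antisymm ?_ ?_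
  · obtain ⟨r, hr⟩ : j (s', t) ∈ Set.range (axisFlow hX z (j (s', t'))) := h ▸ ⟨t, rfl⟩
    have := axisDist_le_dist_axisFlow hX hl (hmem (s, t)) (hmem (s', t')) r
    rw [hr, hj] at this
    simpa [Real.sqrt_sq_eq_abs] using this
  · rw [axisDist_eq hX hl (hmem _) (hmem _)]
    obtain ⟨r, hr⟩ : axisFlow hX z (j (s', t')) (-height z (j (s, t)) (j (s', t'))) ∈
        Set.range fun t : ℝ => j (s', t) := h ▸ ⟨_, rfl⟩
    rw [← hr, hj]
    refine Real.abs_le_sqrt ?_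
    exact le_add_of_nonneg_right (sq_nonneg _)

end Strip

/-- For `m ≥ 3` odd, the boundary lines of the band
`B(a,b) = Min(a) ∩ Min(z) ∩ Min(b)` are (after possibly swapping them) an axis of `ba`
and an axis of `ab` respectively; moreover `a` maps the `ba`-axis boundary line to an
`ab`-axis inside the band, and `b` maps the `ab`-axis boundary line to a `ba`-axis
inside the band. -/
theorem dihedral_artin_band_boundary
    (m : ℕ) (hm : 3 ≤ m) (hodd : Odd m) (X : Type*) [MetricSpace X]
    (hX : IsCAT0 X) (hdim : CovDimLE X 2)
    (φ : PresentedGroup (dihedralRel m) →* (X ≃ᵢ X))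
    (hpd : ProperlyDisc φ) (hss : ∀ g, SemiSimple ⇑(φ g))
    (a b : PresentedGroup (dihedralRel m))
    (haDef : a = PresentedGroup.of 0) (hbDef : b = PresentedGroup.of 1)
    (z : PresentedGroup (dihedralRel m)) (hzDef : z = (altProd a b m) ^ 2)
    (w : ℝ) (hw : 0 < w) (j : Set.Icc (0:ℝ) w × ℝ → X)
    (hstrip : FlatStrip w j)
    (hrange : Set.range j = MinSet ⇑(φ a) ∩ MinSet ⇑(φ z) ∩ MinSet ⇑(φ b))
    (haxes : ∀ s : Set.Icc (0:ℝ) w, IsAxisOf ⇑(φ z) (Set.range fun t : ℝ => j (s, t))) :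
    let L0 : Set X := Set.range fun t : ℝ => j (⟨0, le_rfl, hw.le⟩, t)
    let Lw : Set X := Set.range fun t : ℝ => j (⟨w, hw.le, le_rfl⟩, t)
    let B : Set X := MinSet ⇑(φ a) ∩ MinSet ⇑(φ z) ∩ MinSet ⇑(φ b)
    BoundaryConds ⇑(φ a) ⇑(φ b) ⇑(φ (a * b)) ⇑(φ (b * a)) B L0 Lw ∨
    BoundaryConds ⇑(φ a) ⇑(φ b) ⇑(φ (a * b)) ⇑(φ (b * a)) B Lw L0 := by
  intro L0 Lw B
  obtain ⟨k, rfl⟩ := hodd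
  set d := altProd a b (2 * k + 1) with hd
  have e1 : (a * b) ^ k * a = d := by rw [hd, altProd_two_mul_add_one, mul_pow_mul]
  have e2 : b * (a * b) ^ k = d := by
    rw [← altProd_two_mul_add_one, hd, haDef, hbDef, altProd_of_eq]
  have h1 : (φ a * φ b) ^ k * φ a = φ d := by rw [← e1, map_mul, map_pow, map_mul]
  have h2 : φ b * (φ a * φ b) ^ k = φ d := by rw [← e2, map_mul, map_pow, map_mul]
  have hz : φ d ^ 2 = φ z := by rw [hzDef, map_pow]
  have hB : ∀ v, j v ∈ MinSet ⇑(φ a) ∩ MinSet ⇑(φ z) ∩ MinSet ⇑(φ b) := fun v =>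
    hrange ▸ ⟨v, rfl⟩
  have hmem : ∀ v, j v ∈ MinSet ⇑(φ z) := fun v => (hB v).1.2
  let o : Set.Icc (0 : ℝ) w := ⟨0, le_rfl, hw.le⟩
  let o' : Set.Icc (0 : ℝ) w := ⟨w, hw.le, le_rfl⟩
  have hl : 0 < transLen ⇑(φ z) := by
    refine (transLen_nonneg _).lt_of_ne' fun h0 => ?_
    have hv : dist (j (o, 0)) (φ z (j (o, 0))) = transLen ⇑(φ z) := hmem (o, 0)
    rw [h0, dist_eq_zero] at hv
    have := hpd.isOfFinOrder hv.symm
    rw [hzDef, hd, haDef, hbDef] at this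
    exact not_isOfFinOrder_garside_sq (by omega) this
  have hfree : ∀ v, φ a v ≠ φ b v := by
    intro v hv
    have : φ (b⁻¹ * a) v = v := by
      rw [map_mul, IsometryEquiv.mul_apply, hv, ← IsometryEquiv.mul_apply, ← map_mul,
        inv_mul_cancel, map_one, IsometryEquiv.coe_one, id]
    have := hpd.isOfFinOrder this
    rw [haDef, hbDef] at this
    exact not_isOfFinOrder_inv_mul (by omega) this
  have hsx : SemiSimple ⇑(φ a * φ b) := by rw [← map_mul]; exact hss _
  have hsy : SemiSimple ⇑(φ b * φ a) := by rw [← map_mul]; exact hss _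
  obtain ⟨q, hq, hqx, hqB, hdqB, hbet⟩ := exists_band_endpoint hX hdim h1 h2 hz hl hsx (hss d)
    hfree (hB (o, 0)).1.1 (hmem (o, 0)) (hB (o, 0)).2
  have ca : Commute (φ a) (φ z) := hz ▸ commute_garside_sq_left h1 h2
  have cb : Commute (φ b) (φ z) := hz ▸ commute_garside_sq_right h1 h2
  have cd : Commute (φ d) (φ z) := hz ▸ (Commute.refl (φ d)).pow_right 2
  have cx : Commute (φ a * φ b) (φ z) := ca.mul_left cb
  have cy : Commute (φ b * φ a) (φ z) := cb.mul_left ca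
  have hdq : φ d q ∈ MinSet ⇑(φ z) := commute_mem_minSet _ cd hq
  have hxz : (φ a * φ b) ^ (2 * k + 1) = φ z := hz ▸ garside_sq h1 h2
  have hyz : (φ b * φ a) ^ (2 * k + 1) = φ z := hz ▸ garside_sq' h1 h2
  have hdy : axisDist (φ z) (φ d q) ((φ b * φ a) (φ d q)) = 0 := by
    rw [← IsometryEquiv.mul_apply _ (φ d), garside_mul_mul h1 h2, IsometryEquiv.mul_apply,
      axisDist_map cd, hqx]
  have hqa : axisDist (φ z) q (φ a (φ d q)) = 0 := by
    rw [← IsometryEquiv.mul_apply (φ a), ← garside_mul_right h1 h2, garside_mul_eq_pow h1]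
    exact axisDist_pow_eq_zero hX hl cx hq hqx (k + 1)
  have hqb : axisDist (φ z) (φ d q) (φ b q) = 0 := by
    rw [← h2, IsometryEquiv.mul_apply, axisDist_map cb,
      axisDist_symm hX hl hq (commute_mem_minSet _ (cx.pow_left k) hq)]
    exact axisDist_pow_eq_zero hX hl cx hq hqx k
  -- the boundary conditions hold for the axes through `d q` and `q`
  have main : ∀ s s' : Set.Icc (0 : ℝ) w, φ d q ∈ Set.range (fun t : ℝ => j (s, t)) →
      q ∈ Set.range (fun t : ℝ => j (s', t)) →
      BoundaryConds ⇑(φ a) ⇑(φ b) ⇑(φ (a * b)) ⇑(φ (b * a)) B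
        (Set.range fun t : ℝ => j (s, t)) (Set.range fun t : ℝ => j (s', t)) := by
    intro s s' hs hs'
    have hsB : (Set.range fun t : ℝ => j (s, t)) ⊆ B := by
      rintro _ ⟨t, rfl⟩; exact hB _
    have hsB' : (Set.range fun t : ℝ => j (s', t)) ⊆ B := by
      rintro _ ⟨t, rfl⟩; exact hB _
    rw [(haxes s).eq_range_axisFlow hX hl hs] at hsB ⊢
    rw [(haxes s').eq_range_axisFlow hX hl hs'] at hsB' ⊢
    rw [map_mul, map_mul]
    have ax := isAxisOf_range_axisFlow hX hl (by omega) hxz hsx hq hqx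
    have ay := isAxisOf_range_axisFlow hX hl (by omega) hyz hsy hdq hdy
    have ia := image_range_axisFlow hX hl ca hq hdq hqa
    have ib := image_range_axisFlow hX hl cb hdq hq hqb
    refine ⟨image_range_axisFlow hX hl cy hdq hdq hdy, ay,
      image_range_axisFlow hX hl cx hq hq hqx, ax, ?_, ?_, ?_, ?_⟩
    · rwa [ia]
    · rwa [ia]
    · rwa [ib]
    · rwa [ib]
  obtain ⟨⟨s', t'⟩, hq'⟩ : q ∈ Set.range j := hrange ▸ ⟨⟨hqB.1, hq⟩, hqB.2⟩
  obtain ⟨⟨s, t⟩, hdq'⟩ : φ d q ∈ Set.range j := hrange ▸ ⟨⟨hdqB.1, hdq⟩, hdqB.2⟩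
  have hdist : ∀ r : Set.Icc (0 : ℝ) w,
      |(r : ℝ) - s'| + |(r : ℝ) - s| = |(s' : ℝ) - s| := by
    intro r
    have := hbet (j (r, 0)) (hmem _) (hB (r, 0)).1.1 (hB (r, 0)).2
    rwa [← hdq', ← hq', axisDist_flatStrip hX hl hstrip haxes hmem,
      axisDist_flatStrip hX hl hstrip haxes hmem,
      axisDist_flatStrip hX hl hstrip haxes hmem] at this
  have d0 := hdist o
  have dw := hdist o'
  have b1 := s.2
  have b2 := s'.2
  have main' := main s s' ⟨t, hdq'⟩ ⟨t', hq'⟩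
  simp only [o, o', zero_sub, abs_neg, abs_of_nonneg b1.1, abs_of_nonneg b2.1,
    abs_of_nonneg (sub_nonneg.2 b1.2), abs_of_nonneg (sub_nonneg.2 b2.2)] at d0 dw
  rcases abs_cases ((s' : ℝ) - s) with ⟨e, -⟩ | ⟨e, -⟩
  · left
    have hs : s = o := Subtype.ext (show (s : ℝ) = 0 by linarith)
    have hs' : s' = o' := Subtype.ext (show (s' : ℝ) = w by linarith)
    rwa [hs, hs'] at main'
  · right
    have hs : s = o' := Subtype.ext (show (s : ℝ) = w by linarith)
    have hs' : s' = o := Subtype.ext (show (s' : ℝ) = 0 by linarith)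
    rwa [hs, hs'] at main'
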